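/- arXiv:2402.03075 — 3 statements merged into one kernel-verified Lean document; each statement's English description precedes it below -/
import Mathlib

section
/- Let n ≥ 2, 0 ≤ β < n, 1 < p, p̃₁, p̃₂ < ∞, min{α, α₁} > −n, and suppose (α₁+n)/p = α + n − β. Then the conjugate fractional Hardy operator H*_β maps L¹_{rad}L^{p̃₁}_{ang}(ℝⁿ, |x|^α) to 𝓦L^p_{rad}L^{p̃₂}_{ang}(ℝⁿ, |x|^{α₁}) with operator norm exactly ω_n^{1/p̃₁' + 1/p̃₂} ν_n^{β/n − 1} (1/(n+α₁))^{1/p}. -/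
open MeasureTheory Set ENNReal Metric

/-- The surface measure on the unit sphere `S^{n-1}` in `ℝⁿ`. -/
noncomputable def sphereMeasure (n : ℕ) :
    Measure (sphere (0 : EuclideanSpace ℝ (Fin n)) 1) :=
  (volume : Measure (EuclideanSpace ℝ (Fin n))).toSphere

/-- The weighted mixed radial-angular norm
`‖f‖_{L^p_{rad}L^{pt}_{ang}(ℝⁿ, r^α)} = (∫₀^∞ ‖f(r·)‖_{L^{pt}(S^{n-1})}^p r^{n-1+α} dr)^{1/p}`. -/
noncomputable def mixedNormW (n : ℕ) (p pt α : ℝ)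
    (f : EuclideanSpace ℝ (Fin n) → ℝ) : ℝ≥0∞ :=
  (∫⁻ r in Ioi (0 : ℝ),
    (∫⁻ θ : sphere (0 : EuclideanSpace ℝ (Fin n)) 1,
        ENNReal.ofReal |f (r • (θ : EuclideanSpace ℝ (Fin n)))| ^ pt
      ∂(sphereMeasure n)) ^ (p / pt) *
      ENNReal.ofReal (r ^ ((n : ℝ) - 1 + α))) ^ (1 / p)

/-- The weak weighted mixed radial-angular quasinorm
`sup_{λ>0} λ ‖𝟙_{|g|>λ}‖_{L^p_{rad}L^{pt}_{ang}(ℝⁿ, r^α)}`. -/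
noncomputable def weakMixedNormW (n : ℕ) (p pt α : ℝ)
    (g : EuclideanSpace ℝ (Fin n) → ℝ) : ℝ≥0∞ :=
  ⨆ (lam : ℝ) (_ : 0 < lam),
    ENNReal.ofReal lam * mixedNormW n p pt α (fun x => if lam < |g x| then 1 else 0)

/-- The fractional Hardy operator `H_β f(x) = |B(0,|x|)|^{β/n - 1} ∫_{|y|≤|x|} f(y) dy`. -/
noncomputable def fracHardy (n : ℕ) (β : ℝ) (f : EuclideanSpace ℝ (Fin n) → ℝ)
    (x : EuclideanSpace ℝ (Fin n)) : ℝ :=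
  (volume (ball (0 : EuclideanSpace ℝ (Fin n)) ‖x‖)).toReal ^ (β / n - 1) *
    ∫ y in closedBall (0 : EuclideanSpace ℝ (Fin n)) ‖x‖, f y

/-- The volume `ν_n` of the unit ball in `ℝⁿ`. -/
noncomputable def nu (n : ℕ) : ℝ :=
  (volume (ball (0 : EuclideanSpace ℝ (Fin n)) 1)).toReal

/-- The conjugate fractional Hardy operator
`H*_β f(x) = ∫_{|y| ≥ |x|} f(y) |B(0,|y|)|^{β/n - 1} dy`. -/
noncomputable def conjFracHardy (n : ℕ) (β : ℝ) (f : EuclideanSpace ℝ (Fin n) → ℝ)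
    (x : EuclideanSpace ℝ (Fin n)) : ℝ :=
  ∫ y in {y : EuclideanSpace ℝ (Fin n) | ‖x‖ ≤ ‖y‖},
    f y * (volume (ball (0 : EuclideanSpace ℝ (Fin n)) ‖y‖)).toReal ^ (β / n - 1)

/-- Polar coordinates for the lower Lebesgue integral. -/
lemma lintegral_polar_aux (n : ℕ) (hn : 2 ≤ n) (g : EuclideanSpace ℝ (Fin n) → ℝ≥0∞)
    (hg : Measurable g) :
    ∫⁻ y, g y = ∫⁻ r in Ioi (0 : ℝ), ENNReal.ofReal (r ^ ((n : ℝ) - 1)) *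
      ∫⁻ θ : sphere (0 : EuclideanSpace ℝ (Fin n)) 1, g (r • (θ : EuclideanSpace ℝ (Fin n)))
        ∂(sphereMeasure n) := by
  have : Nontrivial (EuclideanSpace ℝ (Fin n)) := by
    apply Module.nontrivial_of_finrank_pos (R := ℝ); simp; omega
  have hm : Measurable fun z : sphere (0 : EuclideanSpace ℝ (Fin n)) 1 × Ioi (0 : ℝ) =>
      g (z.2.1 • z.1.1) := by
    apply hg.comp; fun_prop
  have hpow : ∀ r : ℝ, 0 < r → r ^ (n - 1) = r ^ ((n : ℝ) - 1) := by
    intro r hr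
    rw [← Real.rpow_natCast, Nat.cast_sub (by omega), Nat.cast_one]
  calc ∫⁻ y, g y = ∫⁻ y : ({0}ᶜ : Set (EuclideanSpace ℝ (Fin n))), g y
        ∂((volume : Measure (EuclideanSpace ℝ (Fin n))).comap Subtype.val) := by
        rw [lintegral_subtype_comap (measurableSet_singleton _).compl, restrict_compl_singleton]
    _ = ∫⁻ z, g (z.2.1 • z.1.1) ∂((volume : Measure (EuclideanSpace ℝ (Fin n))).toSphere.prod
          (.volumeIoiPow (n - 1))) := by
        have h := (volume : Measure
          (EuclideanSpace ℝ (Fin n))).measurePreserving_homeomorphUnitSphereProd.lintegral_comp hm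
        rw [finrank_euclideanSpace_fin] at h
        rw [← h]
        refine lintegral_congr fun y => ?_
        congr 1
        have hy : ‖(y : EuclideanSpace ℝ (Fin n))‖ ≠ 0 := norm_ne_zero_iff.2 y.2
        simp [smul_smul, hy]
    _ = ∫⁻ r : Ioi (0 : ℝ), ∫⁻ θ, g (r.1 • θ.1) ∂(sphereMeasure n) ∂(.volumeIoiPow (n - 1)) := by
        rw [lintegral_prod_symm _ hm.aemeasurable]; rfl
    _ = _ := by
        rw [Measure.volumeIoiPow, lintegral_withDensity_eq_lintegral_mul_non_measurable]
        · rw [← lintegral_subtype_comap measurableSet_Ioi]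
          refine lintegral_congr fun r => ?_
          simp [hpow r.1 r.2]
        · fun_prop
        · simp

lemma nu_pos_aux (n : ℕ) : 0 < nu n := by
  unfold nu
  exact ENNReal.toReal_pos (measure_ball_pos _ _ one_pos).ne' measure_ball_lt_top.ne

lemma sphereMeasure_univ_aux (n : ℕ) :
    sphereMeasure n univ = ENNReal.ofReal (n * nu n) := by
  unfold sphereMeasure nu
  rw [Measure.toSphere_apply_univ, ENNReal.ofReal_mul (by positivity),
    ENNReal.ofReal_toReal measure_ball_lt_top.ne]
  simp

instance finite_sphereMeasure_aux (n : ℕ) : IsFiniteMeasure (sphereMeasure n) := by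
  unfold sphereMeasure; infer_instance

lemma vol_ball_aux (n : ℕ) (hn : 2 ≤ n) (β r : ℝ) (hr : 0 < r) :
    (volume (ball (0 : EuclideanSpace ℝ (Fin n)) r)).toReal ^ (β / n - 1) =
      nu n ^ (β / n - 1) * r ^ (β - n) := by
  have hn0 : (n : ℝ) ≠ 0 := by positivity
  rw [Measure.addHaar_ball_of_pos _ _ hr, ENNReal.toReal_mul, ENNReal.toReal_ofReal (by positivity),
    finrank_euclideanSpace_fin, mul_comm, Real.mul_rpow (by positivity) (by positivity)]
  rw [← Real.rpow_natCast, ← Real.rpow_mul hr.le]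
  congr 2
  field_simp

/-- The conjugate Hardy integral in polar coordinates. -/
lemma hardy_polar_aux (n : ℕ) (hn : 2 ≤ n) (β s : ℝ) (hs : 0 < s)
    (f : EuclideanSpace ℝ (Fin n) → ℝ) (hf : Measurable f) :
    ∫⁻ y in {y : EuclideanSpace ℝ (Fin n) | s ≤ ‖y‖}, ‖f y *
      (volume (ball (0 : EuclideanSpace ℝ (Fin n)) ‖y‖)).toReal ^ (β / n - 1)‖ₑ =
    ENNReal.ofReal (nu n ^ (β / n - 1)) * ∫⁻ r in Ici s,
      (∫⁻ θ : sphere (0 : EuclideanSpace ℝ (Fin n)) 1,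
        ENNReal.ofReal |f (r • (θ : EuclideanSpace ℝ (Fin n)))| ∂(sphereMeasure n)) *
        ENNReal.ofReal (r ^ (β - 1)) := by
  have hS : MeasurableSet {y : EuclideanSpace ℝ (Fin n) | s ≤ ‖y‖} :=
    measurableSet_le measurable_const measurable_norm
  have e1 : ∫⁻ y in {y : EuclideanSpace ℝ (Fin n) | s ≤ ‖y‖}, ‖f y *
      (volume (ball (0 : EuclideanSpace ℝ (Fin n)) ‖y‖)).toReal ^ (β / n - 1)‖ₑ =
      ∫⁻ y, {y : EuclideanSpace ℝ (Fin n) | s ≤ ‖y‖}.indicator (fun y => ENNReal.ofReal |f y| *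
        ENNReal.ofReal (nu n ^ (β / n - 1) * ‖y‖ ^ (β - n))) y := by
    rw [← lintegral_indicator hS]
    refine lintegral_congr fun y => ?_
    by_cases h : y ∈ {y : EuclideanSpace ℝ (Fin n) | s ≤ ‖y‖}
    · rw [indicator_of_mem h, indicator_of_mem h]
      have hy : 0 < ‖y‖ := hs.trans_le h
      rw [vol_ball_aux n hn β _ hy, enorm_mul, Real.enorm_eq_ofReal_abs, Real.enorm_eq_ofReal_abs]
      have := nu_pos_aux n
      rw [abs_of_nonneg (a := _ * _) (by positivity)]
    · rw [indicator_of_notMem h, indicator_of_notMem h]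
  rw [e1, lintegral_polar_aux n hn _ (by
    refine Measurable.indicator ?_ hS
    fun_prop)]
  rw [← lintegral_const_mul' _ _ ENNReal.ofReal_ne_top]
  have hsub : Ici s ⊆ Ioi (0 : ℝ) := fun x hx => hs.trans_le hx
  have e2 : Ici s = Ici s ∩ Ioi 0 := by rw [inter_eq_self_of_subset_left hsub]
  rw [e2, ← setLIntegral_indicator measurableSet_Ici]
  refine setLIntegral_congr_fun measurableSet_Ioi fun r hr => ?_
  have hr : 0 < r := hr
  have hν := nu_pos_aux n
  have hnorm : ∀ θ : sphere (0 : EuclideanSpace ℝ (Fin n)) 1, ‖r • θ.1‖ = r := by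
    intro θ; rw [norm_smul]; simp [abs_of_pos hr]
  by_cases h : s ≤ r
  · have : ∀ θ : sphere (0 : EuclideanSpace ℝ (Fin n)) 1,
      {y : EuclideanSpace ℝ (Fin n) | s ≤ ‖y‖}.indicator (fun y => ENNReal.ofReal |f y| *
        ENNReal.ofReal (nu n ^ (β / n - 1) * ‖y‖ ^ (β - n))) (r • θ.1) =
        ENNReal.ofReal |f (r • θ.1)| * ENNReal.ofReal (nu n ^ (β / n - 1) * r ^ (β - n)) := by
      intro θ
      rw [indicator_of_mem (by simpa [hnorm] using h), hnorm]
    simp only [this]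
    rw [indicator_of_mem (by exact h), lintegral_mul_const' _ _ ENNReal.ofReal_ne_top]
    rw [mul_comm, mul_assoc, ← ENNReal.ofReal_mul (by positivity), mul_left_comm,
      ← ENNReal.ofReal_mul (by positivity), mul_assoc, ← Real.rpow_add hr]
    congr 4
    ring
  · have : ∀ θ : sphere (0 : EuclideanSpace ℝ (Fin n)) 1,
      {y : EuclideanSpace ℝ (Fin n) | s ≤ ‖y‖}.indicator (fun y => ENNReal.ofReal |f y| *
        ENNReal.ofReal (nu n ^ (β / n - 1) * ‖y‖ ^ (β - n))) (r • θ.1) = 0 := by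
      intro θ
      rw [indicator_of_notMem (by simpa [hnorm] using h)]
    simp only [this]
    rw [indicator_of_notMem (by exact h)]
    simp

/-- Pointwise upper bound. -/
lemma hardy_upper_aux (n : ℕ) (hn : 2 ≤ n) (β pt α s : ℝ) (hpt : 1 < pt) (hs : 0 < s)
    (hγ : 0 ≤ α + n - β) (f : EuclideanSpace ℝ (Fin n) → ℝ) (hf : Measurable f) :
    ∫⁻ y in {y : EuclideanSpace ℝ (Fin n) | s ≤ ‖y‖}, ‖f y *
      (volume (ball (0 : EuclideanSpace ℝ (Fin n)) ‖y‖)).toReal ^ (β / n - 1)‖ₑ ≤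
    ENNReal.ofReal (nu n ^ (β / n - 1)) * ENNReal.ofReal ((n * nu n) ^ (1 - 1 / pt)) *
      mixedNormW n 1 pt α f * ENNReal.ofReal (s ^ (-(α + n - β))) := by
  have hν := nu_pos_aux n
  have hω : 0 < n * nu n := by positivity
  rw [hardy_polar_aux n hn β s hs f hf, mul_assoc, mul_assoc]
  gcongr
  have hol : ∀ r : ℝ, (∫⁻ θ : sphere (0 : EuclideanSpace ℝ (Fin n)) 1,
        ENNReal.ofReal |f (r • (θ : EuclideanSpace ℝ (Fin n)))| ∂(sphereMeasure n)) ≤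
      ENNReal.ofReal ((n * nu n) ^ (1 - 1 / pt)) *
      (∫⁻ θ : sphere (0 : EuclideanSpace ℝ (Fin n)) 1,
        ENNReal.ofReal |f (r • (θ : EuclideanSpace ℝ (Fin n)))| ^ pt ∂(sphereMeasure n)) ^
        (1 / pt) := by
    intro r
    have hpq := Real.HolderConjugate.conjExponent hpt
    have hm : Measurable fun θ : sphere (0 : EuclideanSpace ℝ (Fin n)) 1 =>
        ENNReal.ofReal |f (r • (θ : EuclideanSpace ℝ (Fin n)))| := by
      fun_prop
    have := ENNReal.lintegral_mul_le_Lp_mul_Lq (sphereMeasure n) hpq hm.aemeasurable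
      (g := fun _ => 1) aemeasurable_const
    simp only [Pi.mul_apply, mul_one, ENNReal.one_rpow, lintegral_const, one_mul] at this
    rw [sphereMeasure_univ_aux, ENNReal.ofReal_rpow_of_pos hω, mul_comm] at this
    convert this using 4
    have := hpq.inv_add_inv_eq_one
    simp only [one_div]; linarith
  calc _ ≤ ∫⁻ r in Ici s, ENNReal.ofReal ((n * nu n) ^ (1 - 1 / pt)) *
        (((∫⁻ θ : sphere (0 : EuclideanSpace ℝ (Fin n)) 1,
        ENNReal.ofReal |f (r • (θ : EuclideanSpace ℝ (Fin n)))| ^ pt ∂(sphereMeasure n)) ^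
        (1 / pt) * ENNReal.ofReal (r ^ ((n : ℝ) - 1 + α))) *
        ENNReal.ofReal (s ^ (-(α + n - β)))) := by
        refine setLIntegral_mono' measurableSet_Ici fun r hr => ?_
        have hr' : 0 < r := hs.trans_le hr
        have : ENNReal.ofReal (r ^ (β - 1)) ≤ ENNReal.ofReal (r ^ ((n : ℝ) - 1 + α)) *
            ENNReal.ofReal (s ^ (-(α + n - β))) := by
          rw [← ENNReal.ofReal_mul (by positivity)]
          apply ENNReal.ofReal_le_ofReal
          calc r ^ (β - 1) = r ^ ((n : ℝ) - 1 + α) * r ^ (-(α + n - β)) := by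
                rw [← Real.rpow_add hr']; congr 1; ring
            _ ≤ _ := by
                gcongr ?_ * ?_
                exact Real.rpow_le_rpow_of_nonpos hs hr (by linarith)
        calc _ ≤ _ := mul_le_mul' (hol r) this
          _ = _ := by ring
    _ = ENNReal.ofReal ((n * nu n) ^ (1 - 1 / pt)) * ((∫⁻ r in Ici s,
        ((∫⁻ θ : sphere (0 : EuclideanSpace ℝ (Fin n)) 1,
        ENNReal.ofReal |f (r • (θ : EuclideanSpace ℝ (Fin n)))| ^ pt ∂(sphereMeasure n)) ^
        (1 / pt) * ENNReal.ofReal (r ^ ((n : ℝ) - 1 + α)))) *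
        ENNReal.ofReal (s ^ (-(α + n - β)))) := by
        rw [lintegral_const_mul' _ _ ENNReal.ofReal_ne_top,
          lintegral_mul_const' _ _ ENNReal.ofReal_ne_top]
    _ ≤ _ := by
        unfold mixedNormW
        rw [one_div_one, ENNReal.rpow_one]
        gcongr

lemma mixedNormW_mono_aux (n : ℕ) (p pt α : ℝ) (hp : 0 < p) (hpt : 0 < pt)
    (f g : EuclideanSpace ℝ (Fin n) → ℝ) (h : ∀ x, 0 < ‖x‖ → |f x| ≤ |g x|) :
    mixedNormW n p pt α f ≤ mixedNormW n p pt α g := by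
  unfold mixedNormW
  refine ENNReal.rpow_le_rpow ?_ (by positivity)
  refine setLIntegral_mono' measurableSet_Ioi fun r hr => ?_
  have hr : 0 < r := hr
  refine mul_le_mul' (ENNReal.rpow_le_rpow (lintegral_mono fun θ => ENNReal.rpow_le_rpow
    (ENNReal.ofReal_le_ofReal (h _ ?_)) hpt.le) (by positivity)) le_rfl
  rw [norm_smul]; simp [abs_of_pos hr, hr]

lemma lintegral_rpow_aux (a R : ℝ) (ha : -1 < a) (hR : 0 ≤ R) :
    ∫⁻ r in Ioo 0 R, ENNReal.ofReal (r ^ a) = ENNReal.ofReal (R ^ (a + 1) / (a + 1)) := by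
  rw [Measure.restrict_congr_set Ioo_ae_eq_Ioc, ← ofReal_integral_eq_lintegral_ofReal,
    ← intervalIntegral.integral_of_le hR, integral_rpow (Or.inl ha),
    Real.zero_rpow (by linarith), sub_zero]
  · exact (intervalIntegral.intervalIntegrable_rpow' ha).1
  · filter_upwards [ae_restrict_mem measurableSet_Ioc] with y hy
    exact Real.rpow_nonneg hy.1.le _

lemma mixedNormW_ball_aux (n : ℕ) (hn : 2 ≤ n) (p pt α R : ℝ) (hp : 0 < p) (hpt : 0 < pt)
    (hα : -(n : ℝ) < α) (hR : 0 ≤ R) :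
    mixedNormW n p pt α (fun x => if ‖x‖ < R then 1 else 0) =
      ENNReal.ofReal ((n * nu n) ^ (1 / pt) * R ^ ((α + n) / p) * (1 / (n + α)) ^ (1 / p)) := by
  have hν := nu_pos_aux n
  have hω : 0 < n * nu n := by positivity
  unfold mixedNormW
  have : ∀ r ∈ Ioi (0 : ℝ), (∫⁻ θ : sphere (0 : EuclideanSpace ℝ (Fin n)) 1,
        ENNReal.ofReal |(fun x : EuclideanSpace ℝ (Fin n) => if ‖x‖ < R then (1 : ℝ) else 0)
          (r • (θ : EuclideanSpace ℝ (Fin n)))| ^ pt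
      ∂(sphereMeasure n)) ^ (p / pt) * ENNReal.ofReal (r ^ ((n : ℝ) - 1 + α)) =
      (Iio R).indicator (fun r => ENNReal.ofReal ((n * nu n) ^ (p / pt)) *
        ENNReal.ofReal (r ^ ((n : ℝ) - 1 + α))) r := by
    intro r hr
    have hr : 0 < r := hr
    have hnorm : ∀ θ : sphere (0 : EuclideanSpace ℝ (Fin n)) 1, ‖r • θ.1‖ = r := by
      intro θ; rw [norm_smul]; simp [abs_of_pos hr]
    simp only [hnorm]
    by_cases h : r < R
    · rw [indicator_of_mem (by exact h)]
      rw [← ENNReal.ofReal_rpow_of_pos hω, ← sphereMeasure_univ_aux]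
      simp [h]
    · rw [indicator_of_notMem (by exact h)]
      simp [h, hpt, hp]
  rw [setLIntegral_congr_fun measurableSet_Ioi this, setLIntegral_indicator measurableSet_Iio,
    lintegral_const_mul' _ _ ENNReal.ofReal_ne_top, inter_comm, Ioi_inter_Iio,
    lintegral_rpow_aux _ _ (by linarith) hR, ← ENNReal.ofReal_mul (by positivity)]
  have hna : 0 < n + α := by linarith
  rw [show (n : ℝ) - 1 + α + 1 = n + α by ring]
  rw [ENNReal.ofReal_rpow_of_nonneg (by positivity) (by positivity)]
  congr 1
  rw [Real.mul_rpow (x := _ ^ _) (by positivity) (by positivity), div_eq_mul_one_div (R ^ _),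
    Real.mul_rpow (x := R ^ _) (by positivity) (by positivity), ← Real.rpow_mul hω.le, ← Real.rpow_mul hR,
    mul_assoc]
  congr 2
  · field_simp
  · congr 1; field_simp; ring

lemma upper_aux (n : ℕ) (hn : 2 ≤ n) (β p pt₁ pt₂ α α₁ : ℝ)
    (hp : 1 < p) (hpt₁ : 1 < pt₁) (hpt₂ : 1 < pt₂)
    (hα₁ : -(n : ℝ) < α₁)
    (hscale : (α₁ + n) / p = α + n - β)
    (f : EuclideanSpace ℝ (Fin n) → ℝ) (hf : Measurable f) (hfin : mixedNormW n 1 pt₁ α f < ⊤) :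
      weakMixedNormW n p pt₂ α₁ (conjFracHardy n β f)
        ≤ ENNReal.ofReal ((n * nu n) ^ ((1 - 1 / pt₁) + 1 / pt₂) * nu n ^ (β / n - 1) *
            (1 / (n + α₁)) ^ (1 / p)) * mixedNormW n 1 pt₁ α f := by
  have hν := nu_pos_aux n
  have hω : 0 < n * nu n := by positivity
  have hna : 0 < n + α₁ := by linarith
  have hγ : 0 < α + n - β := by rw [← hscale]; apply div_pos <;> linarith
  obtain ⟨N, hN0, hN⟩ : ∃ N : ℝ, 0 ≤ N ∧ mixedNormW n 1 pt₁ α f = ENNReal.ofReal N :=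
    ⟨_, ENNReal.toReal_nonneg, (ENNReal.ofReal_toReal hfin.ne).symm⟩
  set k : ℝ := nu n ^ (β / n - 1) * (n * nu n) ^ (1 - 1 / pt₁) * N with hk
  have hk0 : 0 ≤ k := by positivity
  have hbound : ∀ x : EuclideanSpace ℝ (Fin n), 0 < ‖x‖ →
      |conjFracHardy n β f x| ≤ k * ‖x‖ ^ (-(α + n - β)) := by
    intro x hx
    have h1 := hardy_upper_aux n hn β pt₁ α ‖x‖ hpt₁ hx hγ.le f hf
    have h2 := (enorm_integral_le_lintegral_enorm (μ := volume.restrict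
      {y : EuclideanSpace ℝ (Fin n) | ‖x‖ ≤ ‖y‖}) (fun y => f y *
      (volume (ball (0 : EuclideanSpace ℝ (Fin n)) ‖y‖)).toReal ^ (β / n - 1))).trans h1
    rw [hN, ← ENNReal.ofReal_mul (by positivity), ← ENNReal.ofReal_mul (by positivity),
      ← ENNReal.ofReal_mul (by positivity), Real.enorm_eq_ofReal_abs,
      ENNReal.ofReal_le_ofReal_iff (by positivity)] at h2
    exact h2
  unfold weakMixedNormW
  refine iSup₂_le fun lam hlam => ?_
  set R : ℝ := (k / lam) ^ (1 / (α + n - β)) with hR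
  have hR0 : 0 ≤ R := by positivity
  have hRγ : R ^ (α + n - β) = k / lam := by
    rw [hR, ← Real.rpow_mul (by positivity), one_div_mul_cancel hγ.ne', Real.rpow_one]
  have hmono := mixedNormW_mono_aux n p pt₂ α₁ (by linarith) (by linarith)
    (fun x => if lam < |conjFracHardy n β f x| then 1 else 0) (fun x => if ‖x‖ < R then 1 else 0)
    (by
      intro x hx
      by_cases h : lam < |conjFracHardy n β f x|
      · have h3 := h.trans_le (hbound x hx)
        have h4 : ‖x‖ < R := by
          rw [← Real.rpow_lt_rpow_iff hx.le hR0 hγ, hRγ, lt_div_iff₀ hlam]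
          rw [Real.rpow_neg hx.le, ← div_eq_mul_inv, lt_div_iff₀ (by positivity)] at h3
          linarith
        simp [h, h4]
      · simp [h])
  rw [mixedNormW_ball_aux n hn p pt₂ α₁ R (by linarith) (by linarith) hα₁ hR0, hscale, hRγ] at hmono
  calc _ ≤ ENNReal.ofReal lam * _ := mul_le_mul' le_rfl hmono
    _ = _ := by
      rw [hN, ← ENNReal.ofReal_mul (by positivity), ← ENNReal.ofReal_mul (by positivity)]
      congr 1
      rw [hk, Real.rpow_add hω]
      field_simp

lemma lower_aux (n : ℕ) (hn : 2 ≤ n) (β p pt₁ pt₂ α α₁ : ℝ)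
    (hp : 1 < p) (hpt₁ : 1 < pt₁) (hpt₂ : 1 < pt₂)
    (hα₁ : -(n : ℝ) < α₁)
    (hscale : (α₁ + n) / p = α + n - β) (C : ℝ≥0∞)
    (hC : ∀ f : EuclideanSpace ℝ (Fin n) → ℝ, Measurable f → mixedNormW n 1 pt₁ α f < ⊤ →
        weakMixedNormW n p pt₂ α₁ (conjFracHardy n β f) ≤ C * mixedNormW n 1 pt₁ α f)
    (δ : ℝ) (hδ : 0 < δ) :
    ENNReal.ofReal ((n * nu n) ^ ((1 - 1 / pt₁) + 1 / pt₂) * nu n ^ (β / n - 1) *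
          (1 / (n + α₁)) ^ (1 / p) * (1 + δ) ^ (-(α + n - β) - 1)) ≤ C := by
  have hν := nu_pos_aux n
  have hω : 0 < n * nu n := by positivity
  have hna : 0 < n + α₁ := by linarith
  have hγ : 0 < α + n - β := by rw [← hscale]; apply div_pos <;> linarith
  set φ : ℝ → ℝ := (Icc 1 (1 + δ)).indicator (fun r => r ^ (1 - n - α)) with hφ
  have hφm : Measurable φ := Measurable.indicator (by fun_prop) measurableSet_Icc
  have hφ0 : ∀ r, 0 ≤ φ r := by
    intro r
    refine indicator_nonneg (fun r hr => ?_) r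
    have : 0 < r := by linarith [hr.1]
    positivity
  set f : EuclideanSpace ℝ (Fin n) → ℝ := fun x => φ ‖x‖ with hf
  have hfm : Measurable f := hφm.comp measurable_norm
  have hfr : ∀ r : ℝ, 0 < r → ∀ θ : sphere (0 : EuclideanSpace ℝ (Fin n)) 1, |f (r • θ.1)| = φ r := by
    intro r hr θ
    rw [hf]; simp only
    rw [norm_smul, abs_of_nonneg (hφ0 _)]; simp [abs_of_pos hr]
  have hnorm : mixedNormW n 1 pt₁ α f = ENNReal.ofReal ((n * nu n) ^ (1 / pt₁) * δ) := by
    unfold mixedNormW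
    rw [one_div_one, ENNReal.rpow_one]
    have : ∀ r ∈ Ioi (0 : ℝ), (∫⁻ θ : sphere (0 : EuclideanSpace ℝ (Fin n)) 1,
        ENNReal.ofReal |f (r • (θ : EuclideanSpace ℝ (Fin n)))| ^ pt₁
      ∂(sphereMeasure n)) ^ (1 / pt₁) * ENNReal.ofReal (r ^ ((n : ℝ) - 1 + α)) =
      (Icc 1 (1 + δ)).indicator (fun _ => ENNReal.ofReal ((n * nu n) ^ (1 / pt₁))) r := by
      intro r hr
      have hr : 0 < r := hr
      simp only [hfr r hr, lintegral_const, sphereMeasure_univ_aux]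
      rw [ENNReal.mul_rpow_of_nonneg _ _ (by positivity), ENNReal.ofReal_rpow_of_pos hω,
        ← ENNReal.rpow_mul, mul_one_div_cancel (by positivity), ENNReal.rpow_one]
      by_cases h : r ∈ Icc 1 (1 + δ)
      · rw [hφ, indicator_of_mem h, indicator_of_mem h, mul_assoc, mul_left_comm,
          ← ENNReal.ofReal_mul (by positivity), ← Real.rpow_add hr]
        simp
      · rw [hφ, indicator_of_notMem h, indicator_of_notMem h]; simp
    rw [setLIntegral_congr_fun measurableSet_Ioi this, setLIntegral_indicator measurableSet_Icc,
      inter_eq_self_of_subset_left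
        (show Icc 1 (1 + δ) ⊆ Ioi (0 : ℝ) from fun x hx => lt_of_lt_of_le one_pos hx.1), setLIntegral_const,
      Real.volume_Icc, ← ENNReal.ofReal_mul (by positivity)]
    simp
  have hfin : mixedNormW n 1 pt₁ α f < ⊤ := by rw [hnorm]; exact ENNReal.ofReal_lt_top
  set lam : ℝ := nu n ^ (β / n - 1) * (n * nu n) * (1 + δ) ^ (-(α + n - β) - 1) * δ with hlam
  have hlam0 : 0 < lam := by positivity
  have hH : ∀ x : EuclideanSpace ℝ (Fin n), 0 < ‖x‖ → ‖x‖ < 1 →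
      lam < |conjFracHardy n β f x| := by
    intro x hx hx1
    have hup := hardy_upper_aux n hn β pt₁ α ‖x‖ hpt₁ hx hγ.le f hfm
    have hlt : ∫⁻ y in {y : EuclideanSpace ℝ (Fin n) | ‖x‖ ≤ ‖y‖}, ‖f y *
      (volume (ball (0 : EuclideanSpace ℝ (Fin n)) ‖y‖)).toReal ^ (β / n - 1)‖ₑ < ⊤ := by
      refine hup.trans_lt ?_
      rw [hnorm, ← ENNReal.ofReal_mul (by positivity), ← ENNReal.ofReal_mul (by positivity),
        ← ENNReal.ofReal_mul (by positivity)]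
      exact ENNReal.ofReal_lt_top
    have hlow : ENNReal.ofReal (nu n ^ (β / n - 1) * (n * nu n) * (1 + δ) ^ (-(α + n - β)) * δ) ≤
      ∫⁻ y in {y : EuclideanSpace ℝ (Fin n) | ‖x‖ ≤ ‖y‖}, ‖f y *
      (volume (ball (0 : EuclideanSpace ℝ (Fin n)) ‖y‖)).toReal ^ (β / n - 1)‖ₑ := by
      rw [hardy_polar_aux n hn β _ hx f hfm, mul_assoc, mul_assoc,
        ENNReal.ofReal_mul (by positivity)]
      refine mul_le_mul' le_rfl ?_
      calc ENNReal.ofReal (n * nu n * ((1 + δ) ^ (-(α + n - β)) * δ))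
          = ∫⁻ r in Icc 1 (1 + δ), ENNReal.ofReal (n * nu n * (1 + δ) ^ (-(α + n - β))) := by
            rw [setLIntegral_const, Real.volume_Icc, ← ENNReal.ofReal_mul (by positivity)]
            congr 1; ring
        _ ≤ ∫⁻ r in Icc 1 (1 + δ), (∫⁻ θ : sphere (0 : EuclideanSpace ℝ (Fin n)) 1,
              ENNReal.ofReal |f (r • (θ : EuclideanSpace ℝ (Fin n)))| ∂(sphereMeasure n)) *
              ENNReal.ofReal (r ^ (β - 1)) := by
            refine setLIntegral_mono' measurableSet_Icc fun r hr => ?_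
            have hr0 : 0 < r := lt_of_lt_of_le one_pos hr.1
            simp only [hfr r hr0, lintegral_const, sphereMeasure_univ_aux]
            rw [hφ, indicator_of_mem hr, ← ENNReal.ofReal_mul (by positivity),
              ← ENNReal.ofReal_mul (by positivity)]
            apply ENNReal.ofReal_le_ofReal
            rw [mul_comm (r ^ _), mul_assoc (_ * _) (r ^ _), ← Real.rpow_add hr0]
            gcongr ?_ * ?_
            rw [show 1 - (n : ℝ) - α + (β - 1) = -(α + n - β) by ring]
            exact Real.rpow_le_rpow_of_nonpos hr0 hr.2 (by linarith)
        _ ≤ _ := lintegral_mono_set (fun r hr => hx1.le.trans hr.1)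
    have hnn : ∀ y, 0 ≤ f y *
      (volume (ball (0 : EuclideanSpace ℝ (Fin n)) ‖y‖)).toReal ^ (β / n - 1) := fun y =>
      mul_nonneg (hφ0 _) (by positivity)
    have hvm : Measurable fun y : EuclideanSpace ℝ (Fin n) =>
        (volume (ball (0 : EuclideanSpace ℝ (Fin n)) ‖y‖)).toReal := by
      have : Monotone fun r : ℝ => (volume (ball (0 : EuclideanSpace ℝ (Fin n)) r)).toReal := by
        intro a b hab
        exact ENNReal.toReal_mono measure_ball_lt_top.ne (measure_mono (ball_subset_ball hab))
      exact this.measurable.comp measurable_norm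
    have hint : IntegrableOn (fun y => f y *
      (volume (ball (0 : EuclideanSpace ℝ (Fin n)) ‖y‖)).toReal ^ (β / n - 1))
      {y : EuclideanSpace ℝ (Fin n) | ‖x‖ ≤ ‖y‖} :=
      ⟨(hfm.mul (hvm.pow_const _)).aestronglyMeasurable, hlt⟩
    have heq := ofReal_integral_eq_lintegral_ofReal hint (Filter.Eventually.of_forall hnn)
    have h0 : 0 ≤ conjFracHardy n β f x := integral_nonneg hnn
    have hle : nu n ^ (β / n - 1) * (n * nu n) * (1 + δ) ^ (-(α + n - β)) * δ ≤
        conjFracHardy n β f x := by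
      rw [← ENNReal.ofReal_le_ofReal_iff h0]
      refine hlow.trans (le_of_eq ?_)
      unfold conjFracHardy
      rw [heq]
      refine lintegral_congr fun y => ?_
      rw [Real.enorm_eq_ofReal (hnn y)]
    rw [abs_of_nonneg h0]
    refine lt_of_lt_of_le ?_ hle
    rw [hlam]
    gcongr ?_ * ?_ * ?_ * ?_
    exact Real.rpow_lt_rpow_of_exponent_lt (by linarith) (by linarith)
  have hmain := hC f hfm hfin
  have hmono := mixedNormW_mono_aux n p pt₂ α₁ (by linarith) (by linarith)
    (fun x => if ‖x‖ < 1 then 1 else 0)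
    (fun x => if lam < |conjFracHardy n β f x| then 1 else 0)
    (by
      intro x hx
      by_cases h : ‖x‖ < 1
      · simp [h, hH x hx h]
      · simp [h])
  rw [mixedNormW_ball_aux n hn p pt₂ α₁ 1 (by linarith) (by linarith) hα₁ zero_le_one,
    Real.one_rpow, mul_one] at hmono
  have h1 : ENNReal.ofReal lam * ENNReal.ofReal ((n * nu n) ^ (1 / pt₂) * (1 / (n + α₁)) ^ (1 / p))
      ≤ C * ENNReal.ofReal ((n * nu n) ^ (1 / pt₁) * δ) := by
    rw [← hnorm]
    refine le_trans ?_ hmain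
    refine (mul_le_mul' le_rfl hmono).trans ?_
    unfold weakMixedNormW
    exact le_iSup₂ (f := fun (lam : ℝ) (_ : 0 < lam) => ENNReal.ofReal lam *
      mixedNormW n p pt₂ α₁ (fun x => if lam < |conjFracHardy n β f x| then 1 else 0)) lam hlam0
  have hD : 0 < (n * nu n) ^ (1 / pt₁) * δ := by positivity
  rw [← ENNReal.mul_le_mul_iff_left (c := ENNReal.ofReal ((n * nu n) ^ (1 / pt₁) * δ))
    (by simpa using hD) ENNReal.ofReal_ne_top]
  refine le_trans (le_of_eq ?_) h1
  rw [← ENNReal.ofReal_mul (by positivity), ← ENNReal.ofReal_mul (by positivity)]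
  congr 1
  have e : (n * nu n) ^ (1 - 1 / pt₁ + 1 / pt₂) * (n * nu n) ^ (1 / pt₁) =
      (n * nu n) * (n * nu n) ^ (1 / pt₂) := by
    rw [← Real.rpow_add hω]
    nth_rewrite 2 [← Real.rpow_one (n * nu n)]
    rw [← Real.rpow_add hω]
    congr 1; ring
  rw [hlam]
  linear_combination (nu n ^ (β / n - 1) *
          (1 / (n + α₁)) ^ (1 / p) * (1 + δ) ^ (-(α + n - β) - 1) * δ) * e

/-- Endpoint case for the conjugate fractional Hardy operator: it maps
`L¹_{rad}L^{p̃₁}_{ang}(ℝⁿ, |x|^α)` to `𝓦L^p_{rad}L^{p̃₂}_{ang}(ℝⁿ, |x|^{α₁})` with operator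
norm exactly `ω_n^{1/p̃₁' + 1/p̃₂} ν_n^{β/n − 1} (1/(n+α₁))^{1/p}`. -/
theorem conjFracHardy_mixed_weak_endpoint (n : ℕ) (hn : 2 ≤ n) (β p pt₁ pt₂ α α₁ : ℝ)
    (hβ₀ : 0 ≤ β) (hβn : β < n) (hp : 1 < p) (hpt₁ : 1 < pt₁) (hpt₂ : 1 < pt₂)
    (hα : -(n : ℝ) < α) (hα₁ : -(n : ℝ) < α₁)
    (hscale : (α₁ + n) / p = α + n - β) :
    (∀ f : EuclideanSpace ℝ (Fin n) → ℝ, Measurable f → mixedNormW n 1 pt₁ α f < ⊤ →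
      weakMixedNormW n p pt₂ α₁ (conjFracHardy n β f)
        ≤ ENNReal.ofReal ((n * nu n) ^ ((1 - 1 / pt₁) + 1 / pt₂) * nu n ^ (β / n - 1) *
            (1 / (n + α₁)) ^ (1 / p)) * mixedNormW n 1 pt₁ α f) ∧
    (∀ C : ℝ≥0∞,
      (∀ f : EuclideanSpace ℝ (Fin n) → ℝ, Measurable f → mixedNormW n 1 pt₁ α f < ⊤ →
        weakMixedNormW n p pt₂ α₁ (conjFracHardy n β f) ≤ C * mixedNormW n 1 pt₁ α f) →
      ENNReal.ofReal ((n * nu n) ^ ((1 - 1 / pt₁) + 1 / pt₂) * nu n ^ (β / n - 1) *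
          (1 / (n + α₁)) ^ (1 / p)) ≤ C) := by
  refine ⟨fun f hf hfin => upper_aux n hn β p pt₁ pt₂ α α₁ hp hpt₁ hpt₂ hα₁ hscale f hf hfin,
    fun C hC => ?_⟩
  have hlow := lower_aux n hn β p pt₁ pt₂ α α₁ hp hpt₁ hpt₂ hα₁ hscale C hC
  set A := (n * nu n) ^ ((1 - 1 / pt₁) + 1 / pt₂) * nu n ^ (β / n - 1) *
          (1 / (n + α₁)) ^ (1 / p)
  have hcont : ContinuousAt (fun δ : ℝ =>
      ENNReal.ofReal (A * (1 + δ) ^ (-(α + n - β) - 1))) 0 := by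
    refine ENNReal.continuous_ofReal.continuousAt.comp ?_
    refine continuousAt_const.mul ?_
    exact (continuousAt_const.add continuousAt_id).rpow_const (Or.inl (by simp))
  have ht : Filter.Tendsto (fun δ : ℝ => ENNReal.ofReal (A * (1 + δ) ^ (-(α + n - β) - 1)))
      (nhdsWithin 0 (Ioi 0)) (nhds (ENNReal.ofReal A)) := by
    have := hcont.tendsto.mono_left (nhdsWithin_le_nhds (s := Ioi 0))
    simpa using this
  refine le_of_tendsto ht ?_
  filter_upwards [self_mem_nhdsWithin] with δ hδ
  exact hlow δ hδ
end

section
/- Let ψ : [0,1] → [0,∞), α ∈ ℝ, 1 < p, q < ∞, and suppose ∫₀¹ t^{−α−n/p} ψ(t) dt < ∞. Then U_ψ f(x) = ∫₀¹ f(tx)ψ(t) dt is bounded on the homogeneous Herz space K̇^{α,q}_p(ℝⁿ), and its operator norm is comparable (up to dimensional constants independent of ψ) to ∫₀¹ t^{−α−n/p} ψ(t) dt. -/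
open MeasureTheory Set ENNReal

/-- The dyadic annulus `C_k = {x : 2^{k-1} < |x| ≤ 2^k}`. -/
def annulus (n : ℕ) (k : ℤ) : Set (EuclideanSpace ℝ (Fin n)) :=
  {x | (2 : ℝ) ^ (k - 1) < ‖x‖ ∧ ‖x‖ ≤ (2 : ℝ) ^ k}

/-- The homogeneous Herz norm
`‖f‖_{K̇^{α,q}_p} = (Σ_{k∈ℤ} 2^{kαq} ‖f χ_k‖^q_{L^p})^{1/q}`. -/
noncomputable def herzNorm (n : ℕ) (α p q : ℝ)
    (f : EuclideanSpace ℝ (Fin n) → ℝ) : ℝ≥0∞ :=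
  (∑' k : ℤ, ENNReal.ofReal (((2 : ℝ) ^ k) ^ (α * q)) *
    ((∫⁻ x in annulus n k, ENNReal.ofReal |f x| ^ p) ^ (1 / p)) ^ q) ^ (1 / q)

/-- The weighted Hardy–Littlewood average `U_ψ f (x) = ∫₀¹ f(tx) ψ(t) dt`. -/
noncomputable def hardyLittlewoodAvg (n : ℕ) (ψ : ℝ → ℝ)
    (f : EuclideanSpace ℝ (Fin n) → ℝ) (x : EuclideanSpace ℝ (Fin n)) : ℝ :=
  ∫ t in Ioc (0 : ℝ) 1, f (t • x) * ψ t

theorem mink_core {X T : Type*} [MeasurableSpace X] [MeasurableSpace T] (μ : Measure X)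
    (ν : Measure T) [SFinite μ] [SFinite ν] (p : ℝ) (hp : 1 < p) (G : X → T → ℝ≥0∞)
    (hG : Measurable (Function.uncurry G)) (h : X → ℝ≥0∞) (hh : Measurable h)
    (hle : ∀ x, h x ≤ ∫⁻ t, G x t ∂ν) (hfin : ∫⁻ x, h x ^ p ∂μ ≠ ⊤) :
    (∫⁻ x, h x ^ p ∂μ) ^ (1 / p) ≤ ∫⁻ t, (∫⁻ x, G x t ^ p ∂μ) ^ (1 / p) ∂ν := by
  have hp0 : 0 < p := by linarith
  by_cases h0 : ∫⁻ x, h x ^ p ∂μ = 0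
  · rw [h0, ENNReal.zero_rpow_of_pos (by positivity)]; exact zero_le
  set a := ∫⁻ x, h x ^ p ∂μ with ha
  have hc : p.HolderConjugate (p / (p - 1)) := Real.HolderConjugate.conjExponent hp
  set p' := p / (p - 1) with hp'
  have hG1 : ∀ t, Measurable fun x => G x t := fun t => hG.comp (measurable_id.prodMk measurable_const)
  have hG2 : ∀ x, Measurable fun t => G x t := fun x => hG.comp (measurable_const.prodMk measurable_id)
  have key : a ≤ (∫⁻ t, (∫⁻ x, G x t ^ p ∂μ) ^ (1 / p) ∂ν) * a ^ (1 / p') := by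
    calc a ≤ ∫⁻ x, (∫⁻ t, G x t ∂ν) * h x ^ (p - 1) ∂μ := by
          refine lintegral_mono fun x => ?_
          calc h x ^ p = h x ^ (1 + (p - 1)) := by ring_nf
            _ = h x * h x ^ (p - 1) := by
              rw [ENNReal.rpow_add_of_nonneg _ _ (by norm_num) (by linarith), ENNReal.rpow_one]
            _ ≤ _ := by gcongr; exact hle x
      _ = ∫⁻ x, ∫⁻ t, G x t * h x ^ (p - 1) ∂ν ∂μ := by
          refine lintegral_congr fun x => ?_
          rw [lintegral_mul_const _ (hG2 x)]
      _ = ∫⁻ t, ∫⁻ x, G x t * h x ^ (p - 1) ∂μ ∂ν := by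
          apply lintegral_lintegral_swap
          exact (hG.mul ((hh.pow_const _).comp measurable_fst)).aemeasurable
      _ ≤ ∫⁻ t, (∫⁻ x, G x t ^ p ∂μ) ^ (1 / p) * a ^ (1 / p') ∂ν := by
          refine lintegral_mono fun t => ?_
          refine (ENNReal.lintegral_mul_le_Lp_mul_Lq μ hc (hG1 t).aemeasurable
            (hh.pow_const (p - 1)).aemeasurable).trans (le_of_eq ?_)
          congr 2
          refine lintegral_congr fun x => ?_
          rw [← ENNReal.rpow_mul]
          congr 1
          rw [hp']; have : p - 1 ≠ 0 := by linarith
          field_simp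
      _ = _ := by
          rw [lintegral_mul_const' _ _ (ENNReal.rpow_ne_top_of_nonneg hc.symm.one_div_nonneg hfin)]
  have hsplit : a = a ^ (1 / p) * a ^ (1 / p') := by
    rw [← ENNReal.rpow_add _ _ h0 hfin]
    have := hc.inv_add_inv_eq_one
    rw [one_div, one_div, this, ENNReal.rpow_one]
  nth_rewrite 1 [hsplit] at key
  refine (ENNReal.mul_le_mul_iff_left ?_ ?_).1 key
  · exact (ENNReal.rpow_pos (pos_iff_ne_zero.2 h0) hfin).ne'
  · exact (ENNReal.rpow_ne_top_of_nonneg hc.symm.one_div_nonneg hfin)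

theorem mink {X T : Type*} [MeasurableSpace X] [MeasurableSpace T] (μ : Measure X)
    (ν : Measure T) [SigmaFinite μ] [SFinite ν] (p : ℝ) (hp : 1 < p) (G : X → T → ℝ≥0∞)
    (hG : Measurable (Function.uncurry G)) :
    (∫⁻ x, (∫⁻ t, G x t ∂ν) ^ p ∂μ) ^ (1 / p) ≤ ∫⁻ t, (∫⁻ x, G x t ^ p ∂μ) ^ (1 / p) ∂ν := by
  have hp0 : 0 < p := by linarith
  set H : X → ℝ≥0∞ := fun x => ∫⁻ t, G x t ∂ν with hH
  have hHm : Measurable H := hG.lintegral_prod_right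
  set h : ℕ → X → ℝ≥0∞ := fun N => (spanningSets μ N).indicator fun x => min (H x) N with hhdef
  have hm : ∀ N, Measurable (h N) := fun N =>
    (hHm.min measurable_const).indicator (measurableSet_spanningSets μ N)
  have hle : ∀ N x, h N x ≤ H x := by
    intro N x
    refine (indicator_le_self _ _ _).trans (min_le_left _ _)
  have hmono : ∀ x, Monotone fun N => h N x := by
    intro x M N hMN
    simp only [hhdef, indicator]
    split_ifs with h1 h2
    · gcongr
    · exact absurd (monotone_spanningSets μ hMN h1) h2
    · exact zero_le
    · exact le_rfl
  have hsup : ∀ x, ⨆ N, h N x = H x := by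
    intro x
    refine le_antisymm (iSup_le fun N => hle N x) ?_
    refine le_of_forall_lt fun c hc => ?_
    obtain ⟨N, hN⟩ := ENNReal.exists_nat_gt (ne_top_of_lt hc)
    obtain ⟨M, hM⟩ : ∃ M, x ∈ spanningSets μ M := by
      have : x ∈ ⋃ i, spanningSets μ i := by rw [iUnion_spanningSets]; trivial
      exact mem_iUnion.1 this
    refine lt_of_lt_of_le ?_ (le_iSup _ (max M N))
    simp only [hhdef]
    rw [indicator_of_mem (monotone_spanningSets μ (le_max_left M N) hM)]
    refine lt_min hc (hN.trans_le ?_)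
    exact_mod_cast le_max_right M N
  have hint : ∫⁻ x, H x ^ p ∂μ = ⨆ N, ∫⁻ x, h N x ^ p ∂μ := by
    rw [← lintegral_iSup (fun N => (hm N).pow_const p)
      (fun M N hMN x => ENNReal.rpow_le_rpow (hmono x hMN) hp0.le)]
    refine lintegral_congr fun x => ?_
    rw [← hsup x]
    exact (ENNReal.orderIsoRpow p hp0).map_iSup (fun N => h N x)
  rw [one_div, ENNReal.rpow_inv_le_iff hp0, hint]
  refine iSup_le fun N => ?_
  rw [← ENNReal.rpow_inv_le_iff hp0, ← one_div]
  refine mink_core μ ν p hp G hG (h N) (hm N) (hle N) ?_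
  refine ne_top_of_le_ne_top ?_ (b := ∫⁻ x, (spanningSets μ N).indicator (fun _ => (N : ℝ≥0∞) ^ p) x ∂μ) ?_
  · rw [lintegral_indicator (measurableSet_spanningSets μ N)]
    simp only [lintegral_const, Measure.restrict_apply_univ]
    exact ENNReal.mul_ne_top (by simp [hp0.le]) (measure_spanningSets_lt_top μ N).ne
  · refine lintegral_mono fun x => ?_
    simp only [hhdef, indicator]
    split_ifs
    · gcongr; exact min_le_right _ _
    · simp [hp0]

noncomputable def nk (n : ℕ) (p : ℝ) (k : ℤ) (F : EuclideanSpace ℝ (Fin n) → ℝ≥0∞) : ℝ≥0∞ :=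
  (∫⁻ x in annulus n k, F x ^ p) ^ (1 / p)

noncomputable def wk (α : ℝ) (k : ℤ) : ℝ≥0∞ := ENNReal.ofReal (((2 : ℝ) ^ k) ^ α)

noncomputable def hnorm (n : ℕ) (α p q : ℝ) (F : EuclideanSpace ℝ (Fin n) → ℝ≥0∞) : ℝ≥0∞ :=
  (∑' k : ℤ, (wk α k * nk n p k F) ^ q) ^ (1 / q)

theorem herz_eq (n : ℕ) (α p q : ℝ) (hq : 1 < q) (f : EuclideanSpace ℝ (Fin n) → ℝ) :
    herzNorm n α p q f = hnorm n α p q (fun x => ENNReal.ofReal |f x|) := by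
  unfold herzNorm hnorm nk wk
  congr 1
  refine tsum_congr fun k => ?_
  rw [ENNReal.mul_rpow_of_nonneg _ _ (by linarith), Real.rpow_mul (by positivity),
    ENNReal.ofReal_rpow_of_nonneg (by positivity) (by linarith)]

theorem measurableSet_annulus (n : ℕ) (k : ℤ) : MeasurableSet (annulus n k) :=
  (measurableSet_lt measurable_const measurable_norm).inter
    (measurableSet_le measurable_norm measurable_const)

theorem nk_mono {n : ℕ} {p : ℝ} (hp : 1 < p) {k : ℤ} {F G : EuclideanSpace ℝ (Fin n) → ℝ≥0∞}
    (h : ∀ x ∈ annulus n k, F x ≤ G x) : nk n p k F ≤ nk n p k G := by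
  unfold nk
  refine ENNReal.rpow_le_rpow ?_ (by positivity)
  refine setLIntegral_mono' (measurableSet_annulus n k) fun x hx => ?_
  exact ENNReal.rpow_le_rpow (h x hx) (by linarith)

theorem hnorm_mono {n : ℕ} {α p q : ℝ} (hp : 1 < p) (hq : 1 < q)
    {F G : EuclideanSpace ℝ (Fin n) → ℝ≥0∞}
    (h : ∀ x, F x ≤ G x) : hnorm n α p q F ≤ hnorm n α p q G := by
  unfold hnorm
  refine ENNReal.rpow_le_rpow ?_ (by positivity)
  refine ENNReal.tsum_le_tsum fun k => ?_
  refine ENNReal.rpow_le_rpow ?_ (by positivity)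
  gcongr
  exact nk_mono hp fun x _ => h x

theorem nk_const_mul {n : ℕ} {p : ℝ} (hp : 1 < p) {k : ℤ} (F : EuclideanSpace ℝ (Fin n) → ℝ≥0∞)
    (c : ℝ≥0∞) (hc : c ≠ ⊤) : nk n p k (fun x => c * F x) = c * nk n p k F := by
  unfold nk
  have hp0 : 0 < p := by linarith
  simp_rw [ENNReal.mul_rpow_of_nonneg _ _ hp0.le]
  rw [lintegral_const_mul' _ _ (ENNReal.rpow_ne_top_of_nonneg hp0.le hc),
    ENNReal.mul_rpow_of_nonneg _ _ (by positivity), ← ENNReal.rpow_mul, mul_one_div_cancel hp0.ne',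
    ENNReal.rpow_one]

theorem lint_smul (n : ℕ) (G : EuclideanSpace ℝ (Fin n) → ℝ≥0∞) (hG : Measurable G) (t : ℝ)
    (ht : 0 < t) : ∫⁻ x, G (t • x) = ENNReal.ofReal ((t ^ n)⁻¹) * ∫⁻ x, G x := by
  have := Measure.map_addHaar_smul (volume : Measure (EuclideanSpace ℝ (Fin n))) ht.ne'
  rw [← lintegral_map (g := fun x => t • x) hG (by fun_prop), this, lintegral_smul_measure]
  simp [abs_of_pos ht]

/-- The `L^p` norm of a dilate on an annulus. -/
theorem nk_smul (n : ℕ) (p : ℝ) (hp : 1 < p) (k : ℤ) (F : EuclideanSpace ℝ (Fin n) → ℝ≥0∞)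
    (hF : Measurable F) (t : ℝ) (ht : 0 < t) :
    nk n p k (fun x => F (t • x)) = ENNReal.ofReal (t ^ (-(n / p) : ℝ)) *
      (∫⁻ x in {x | t * 2 ^ (k - 1) < ‖x‖ ∧ ‖x‖ ≤ t * 2 ^ k}, F x ^ p) ^ (1 / p) := by
  unfold nk
  have hS : MeasurableSet {x : EuclideanSpace ℝ (Fin n) | t * 2 ^ (k - 1) < ‖x‖ ∧ ‖x‖ ≤ t * 2 ^ k} :=
    (measurableSet_lt measurable_const measurable_norm).inter
      (measurableSet_le measurable_norm measurable_const)
  have e := lint_smul n ({x | t * 2 ^ (k - 1) < ‖x‖ ∧ ‖x‖ ≤ t * 2 ^ k}.indicator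
    fun x => F x ^ p) ((hF.pow_const p).indicator hS) t ht
  rw [lintegral_indicator hS] at e
  have e2 : ∫⁻ x in annulus n k, F (t • x) ^ p = ∫⁻ x,
      ({x : EuclideanSpace ℝ (Fin n) | t * 2 ^ (k - 1) < ‖x‖ ∧ ‖x‖ ≤ t * 2 ^ k}.indicator
    fun x => F x ^ p) (t • x) := by
    rw [← lintegral_indicator (measurableSet_annulus n k)]
    refine lintegral_congr fun x => ?_
    have : (t • x ∈ {x : EuclideanSpace ℝ (Fin n) | t * 2 ^ (k - 1) < ‖x‖ ∧ ‖x‖ ≤ t * 2 ^ k}) ↔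
        x ∈ annulus n k := by
      simp only [annulus, mem_ofPred_eq, norm_smul, Real.norm_eq_abs, abs_of_pos ht,
        mul_lt_mul_iff_right₀ ht, mul_le_mul_iff_right₀ ht]
    by_cases h : x ∈ annulus n k
    · rw [indicator_of_mem h, indicator_of_mem (this.2 h)]
    · rw [indicator_of_notMem h, indicator_of_notMem (fun h' => h (this.1 h'))]
  rw [e2, e, ENNReal.mul_rpow_of_nonneg _ _ (by positivity)]
  congr 1
  rw [ENNReal.ofReal_rpow_of_nonneg (by positivity) (by positivity)]
  congr 1
  rw [Real.rpow_neg ht.le, ← Real.rpow_natCast, ← Real.rpow_neg ht.le, ← Real.rpow_mul ht.le,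
    ← Real.rpow_neg ht.le]
  congr 1
  ring

theorem exists_m (t : ℝ) (ht : 0 < t) : ∃ m : ℤ, (2 : ℝ) ^ (m - 1) < t ∧ t ≤ 2 ^ m := by
  obtain ⟨m, h1, h2⟩ := exists_mem_Ioc_zpow ht (one_lt_two)
  exact ⟨m + 1, by simpa using h1, h2⟩

theorem wk_le (α : ℝ) (k j : ℤ) (t : ℝ) (ht : 0 < t) (h1 : t * 2 ^ k ≤ 2 * 2 ^ j)
    (h2 : (2 : ℝ) ^ j ≤ 2 * (t * 2 ^ k)) :
    wk α k ≤ ENNReal.ofReal (2 ^ |α| * t ^ (-α)) * wk α j := by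
  unfold wk
  have hk : (0 : ℝ) < 2 ^ k := by positivity
  have hj : (0 : ℝ) < 2 ^ j := by positivity
  generalize (2 : ℝ) ^ k = a at *
  generalize (2 : ℝ) ^ j = b at *
  rw [← ENNReal.ofReal_mul (by positivity)]
  refine ENNReal.ofReal_le_ofReal ?_
  have hr : (t * a) ^ α ≤ 2 ^ |α| * b ^ α := by
    rcases le_total 0 α with h | h
    · rw [abs_of_nonneg h, ← Real.mul_rpow (by norm_num) hj.le]
      exact Real.rpow_le_rpow (by positivity) h1 h
    · rw [abs_of_nonpos h, Real.rpow_neg (by norm_num), ← Real.inv_rpow (by norm_num), ← Real.mul_rpow (by norm_num) hj.le]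
      refine Real.rpow_le_rpow_of_nonpos (by positivity) (by linarith) h
  rw [Real.mul_rpow ht.le hk.le] at hr
  have e : t ^ (-α) * t ^ α = 1 := by rw [← Real.rpow_add ht]; simp
  calc a ^ α = t ^ (-α) * (t ^ α * a ^ α) := by rw [← mul_assoc, e, one_mul]
    _ ≤ t ^ (-α) * (2 ^ |α| * b ^ α) := by gcongr
    _ = _ := by ring

theorem wk_nk_smul (n : ℕ) (α p : ℝ) (hp : 1 < p) (F : EuclideanSpace ℝ (Fin n) → ℝ≥0∞)
    (hF : Measurable F) (t : ℝ) (ht : 0 < t) (m : ℤ) (hm1 : (2 : ℝ) ^ (m - 1) < t)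
    (hm2 : t ≤ 2 ^ m) (k : ℤ) :
    wk α k * nk n p k (fun x => F (t • x)) ≤ ENNReal.ofReal (2 ^ |α| * t ^ (-α - n / p)) *
      (wk α (k + m) * nk n p (k + m) F + wk α (k + (m - 1)) * nk n p (k + (m - 1)) F) := by
  have hp0 : 0 < p := by linarith
  rw [nk_smul n p hp k F hF t ht]
  have hk : (0 : ℝ) < 2 ^ k := by positivity
  have ekm : (2 : ℝ) ^ (k + m) = 2 ^ k * 2 ^ m := zpow_add₀ (by norm_num) _ _
  have em : (2 : ℝ) ^ m = 2 * 2 ^ (m - 1) := by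
    rw [zpow_sub_one₀ (by norm_num)]; ring
  have ek : (2 : ℝ) ^ k = 2 * 2 ^ (k - 1) := by
    rw [zpow_sub_one₀ (by norm_num)]; ring
  have ekm1 : (2 : ℝ) ^ (k + (m - 1)) = 2 ^ k * 2 ^ (m - 1) := zpow_add₀ (by norm_num) _ _
  have ekm2 : (2 : ℝ) ^ (k + (m - 1) - 1) = 2 ^ (k - 1) * 2 ^ (m - 1) := by
    rw [← zpow_add₀ (by norm_num)]; ring_nf
  have hsub : {x : EuclideanSpace ℝ (Fin n) | t * 2 ^ (k - 1) < ‖x‖ ∧ ‖x‖ ≤ t * 2 ^ k} ⊆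
      annulus n (k + m) ∪ annulus n (k + (m - 1)) := by
    rintro x ⟨hx1, hx2⟩
    by_cases hx : (2 : ℝ) ^ (k + (m - 1)) < ‖x‖
    · left
      refine ⟨by rwa [add_sub_assoc], hx2.trans ?_⟩
      rw [ekm, mul_comm]; gcongr
    · right
      refine ⟨lt_of_le_of_lt ?_ hx1, not_lt.1 hx⟩
      rw [ekm2, mul_comm]; gcongr
  have hN : (∫⁻ x in {x | t * 2 ^ (k - 1) < ‖x‖ ∧ ‖x‖ ≤ t * 2 ^ k}, F x ^ p) ^ (1 / p) ≤
      nk n p (k + m) F + nk n p (k + (m - 1)) F := by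
    unfold nk
    refine le_trans ?_ (ENNReal.rpow_add_le_add_rpow _ _ (by positivity) ?_)
    · refine ENNReal.rpow_le_rpow ?_ (by positivity)
      exact (lintegral_mono_set hsub).trans (lintegral_union_le _ _ _)
    · rw [div_le_one hp0]; exact hp.le
  have w1 := wk_le α k (k + m) t ht (by rw [ekm]; nlinarith) (by rw [ekm, em]; nlinarith)
  have w2 := wk_le α k (k + (m - 1)) t ht (by rw [ekm1]; nlinarith) (by rw [ekm1]; nlinarith)
  have es : ENNReal.ofReal (2 ^ |α| * t ^ (-α - n / p)) =
      ENNReal.ofReal (2 ^ |α| * t ^ (-α)) * ENNReal.ofReal (t ^ (-(n / p) : ℝ)) := by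
    rw [← ENNReal.ofReal_mul (by positivity), mul_assoc, ← Real.rpow_add ht]
    rfl
  rw [es]
  set A := ENNReal.ofReal (2 ^ |α| * t ^ (-α))
  set B := ENNReal.ofReal (t ^ (-(n / p) : ℝ))
  calc _ ≤ wk α k * (B * (nk n p (k + m) F + nk n p (k + (m - 1)) F)) := by gcongr
    _ = B * (wk α k * nk n p (k + m) F + wk α k * nk n p (k + (m - 1)) F) := by ring
    _ ≤ B * (A * wk α (k + m) * nk n p (k + m) F + A * wk α (k + (m - 1)) * nk n p (k + (m - 1)) F) := by
      gcongr
    _ = _ := by ring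

theorem hnorm_smul (n : ℕ) (α p q : ℝ) (hp : 1 < p) (hq : 1 < q)
    (F : EuclideanSpace ℝ (Fin n) → ℝ≥0∞)
    (hF : Measurable F) (t : ℝ) (ht : 0 < t) :
    hnorm n α p q (fun x => F (t • x)) ≤
      ENNReal.ofReal (2 * 2 ^ |α|) * ENNReal.ofReal (t ^ (-α - n / p)) * hnorm n α p q F := by
  obtain ⟨m, hm1, hm2⟩ := exists_m t ht
  have hq0 : 0 < q := by linarith
  set b : ℤ → ℝ≥0∞ := fun k => wk α k * nk n p k F with hb
  set c := ENNReal.ofReal (2 ^ |α| * t ^ (-α - n / p)) with hc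
  have hct : c ≠ ⊤ := ENNReal.ofReal_ne_top
  have hshift : ∀ j : ℤ, (∑' k : ℤ, b (k + j) ^ q) = ∑' k : ℤ, b k ^ q := fun j =>
    (Equiv.addRight j).tsum_eq (fun k => b k ^ q)
  have hadd := ENNReal.lintegral_Lp_add_le (μ := Measure.count) (p := q)
    (f := fun k : ℤ => b (k + m)) (g := fun k : ℤ => b (k + (m - 1)))
    (measurable_from_top).aemeasurable (measurable_from_top).aemeasurable hq.le
  rw [lintegral_count, lintegral_count, lintegral_count, hshift, hshift] at hadd
  have e2 : ENNReal.ofReal (2 * 2 ^ |α|) * ENNReal.ofReal (t ^ (-α - n / p)) = c * 2 := by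
    rw [hc, ← ENNReal.ofReal_mul (by positivity), mul_assoc, ENNReal.ofReal_mul (by norm_num)]
    simp [mul_comm]
  rw [e2]
  calc hnorm n α p q (fun x => F (t • x))
      ≤ (∑' k : ℤ, (c * (b (k + m) + b (k + (m - 1)))) ^ q) ^ (1 / q) := by
        unfold hnorm
        refine ENNReal.rpow_le_rpow (ENNReal.tsum_le_tsum fun k =>
          ENNReal.rpow_le_rpow ?_ hq0.le) (by positivity)
        exact wk_nk_smul n α p hp F hF t ht m hm1 hm2 k
    _ = c * (∑' k : ℤ, (b (k + m) + b (k + (m - 1))) ^ q) ^ (1 / q) := by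
        simp_rw [ENNReal.mul_rpow_of_nonneg _ _ hq0.le]
        rw [ENNReal.tsum_mul_left, ENNReal.mul_rpow_of_nonneg _ _ (by positivity),
          ← ENNReal.rpow_mul, mul_one_div_cancel hq0.ne', ENNReal.rpow_one]
    _ ≤ c * (hnorm n α p q F + hnorm n α p q F) := by
        gcongr
        exact hadd
    _ = _ := by ring

theorem hnorm_mink (n : ℕ) (α p q : ℝ) (hp : 1 < p) (hq : 1 < q) (ν : Measure ℝ) [SFinite ν]
    (G : EuclideanSpace ℝ (Fin n) → ℝ → ℝ≥0∞) (hG : Measurable (Function.uncurry G)) :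
    hnorm n α p q (fun x => ∫⁻ t, G x t ∂ν) ≤ ∫⁻ t, hnorm n α p q (fun x => G x t) ∂ν := by
  have hm : ∀ k : ℤ, Measurable fun t => wk α k * nk n p k (fun x => G x t) := by
    intro k
    unfold nk
    refine Measurable.const_mul (Measurable.pow_const ?_ _) _
    exact Measurable.lintegral_prod_left' (f := fun z => Function.uncurry G z ^ p) (hG.pow_const p)
  have h2 := mink (Measure.count : Measure ℤ) ν q hq
    (fun k t => wk α k * nk n p k (fun x => G x t)) (measurable_from_prod_countable_right hm)
  simp only [lintegral_count] at h2
  refine le_trans ?_ h2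
  unfold hnorm
  gcongr with k
  have h1 := mink (volume.restrict (annulus n k)) ν p hp G hG
  rw [lintegral_const_mul' _ _ (by simp [wk])]
  gcongr
  exact h1
theorem upper (n : ℕ) (α p q : ℝ) (hp : 1 < p) (hq : 1 < q) (ψ : ℝ → ℝ)
    (hψ : ∀ t ∈ Icc (0 : ℝ) 1, 0 ≤ ψ t) (hψm : Measurable ψ)
    (f : EuclideanSpace ℝ (Fin n) → ℝ) (hf : Measurable f) :
    herzNorm n α p q (hardyLittlewoodAvg n ψ f) ≤ ENNReal.ofReal (2 * 2 ^ |α|) *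
      (∫⁻ t in Ioc (0 : ℝ) 1, ENNReal.ofReal (t ^ (-α - n / p) * ψ t)) * herzNorm n α p q f := by
  rw [herz_eq n α p q hq, herz_eq n α p q hq]
  set F : EuclideanSpace ℝ (Fin n) → ℝ≥0∞ := fun x => ENNReal.ofReal |f x| with hF
  have hFm : Measurable F := (hf.abs).ennreal_ofReal
  set G : EuclideanSpace ℝ (Fin n) → ℝ → ℝ≥0∞ := fun x t => ENNReal.ofReal |ψ t| * F (t • x) with hG
  have hGm : Measurable (Function.uncurry G) := by
    refine Measurable.mul ?_ (hFm.comp (measurable_snd.smul measurable_fst))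
    exact ((hψm.comp measurable_snd).abs).ennreal_ofReal
  calc _ ≤ hnorm n α p q (fun x => ∫⁻ t in Ioc (0 : ℝ) 1, G x t) := by
        refine hnorm_mono hp hq fun x => ?_
        unfold hardyLittlewoodAvg
        rw [← Real.enorm_eq_ofReal_abs]
        refine (enorm_integral_le_lintegral_enorm _).trans (le_of_eq ?_)
        refine lintegral_congr fun t => ?_
        rw [Real.enorm_eq_ofReal_abs, abs_mul, ENNReal.ofReal_mul (abs_nonneg _), mul_comm]
    _ ≤ ∫⁻ t in Ioc (0 : ℝ) 1, hnorm n α p q (fun x => G x t) :=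
        hnorm_mink n α p q hp hq _ G hGm
    _ ≤ ∫⁻ t in Ioc (0 : ℝ) 1, ENNReal.ofReal (2 * 2 ^ |α|) *
          ENNReal.ofReal (t ^ (-α - n / p) * ψ t) * hnorm n α p q F := by
        refine setLIntegral_mono' measurableSet_Ioc fun t ht => ?_
        have hq0 : 0 < q := by linarith
        have e : hnorm n α p q (fun x => G x t) =
            ENNReal.ofReal |ψ t| * hnorm n α p q (fun x => F (t • x)) := by
          unfold hnorm
          simp only [hG]
          simp_rw [nk_const_mul hp (fun x => F (t • x)) _ (ENNReal.ofReal_ne_top)]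
          simp_rw [mul_left_comm _ (ENNReal.ofReal |ψ t|), ENNReal.mul_rpow_of_nonneg _ _ hq0.le]
          rw [ENNReal.tsum_mul_left, ENNReal.mul_rpow_of_nonneg _ _ (by positivity),
            ← ENNReal.rpow_mul, mul_one_div_cancel hq0.ne', ENNReal.rpow_one]
        rw [e, abs_of_nonneg (hψ t ⟨ht.1.le, ht.2⟩),
          ENNReal.ofReal_mul (Real.rpow_nonneg ht.1.le _)]
        calc _ ≤ _ := mul_le_mul_right (hnorm_smul n α p q hp hq F hFm t ht.1) _
          _ = _ := by ring
    _ = _ := by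
        rw [lintegral_mul_const, lintegral_const_mul]
        · fun_prop
        · fun_prop

noncomputable def Phi (n : ℕ) (γ : ℝ) (x : EuclideanSpace ℝ (Fin n)) : ℝ≥0∞ :=
  ENNReal.ofReal (‖x‖ ^ γ)

theorem Phi_meas (n : ℕ) (γ : ℝ) : Measurable (Phi n γ) := by
  unfold Phi; fun_prop

theorem wk_nk_Phi (n : ℕ) (α p : ℝ) (hp : 1 < p) (k : ℤ) :
    wk α k * nk n p k (Phi n (-α - n / p)) = nk n p 0 (Phi n (-α - n / p)) := by
  have ht : (0 : ℝ) < 2 ^ k := by positivity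
  have h := nk_smul n p hp 0 (Phi n (-α - n / p)) (Phi_meas n _) ((2 : ℝ) ^ k) ht
  have e1 : (fun x => Phi n (-α - n / p) ((2 : ℝ) ^ k • x)) = fun x =>
      ENNReal.ofReal (((2 : ℝ) ^ k) ^ (-α - n / p)) * Phi n (-α - n / p) x := by
    funext x
    unfold Phi
    rw [norm_smul, Real.norm_eq_abs, abs_of_pos ht, Real.mul_rpow ht.le (norm_nonneg _),
      ENNReal.ofReal_mul (by positivity)]
  have e2 : {x : EuclideanSpace ℝ (Fin n) | (2 : ℝ) ^ k * 2 ^ ((0 : ℤ) - 1) < ‖x‖ ∧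
      ‖x‖ ≤ (2 : ℝ) ^ k * 2 ^ (0 : ℤ)} = annulus n k := by
    unfold annulus
    rw [← zpow_add₀ (by norm_num), ← zpow_add₀ (by norm_num)]
    simp [sub_eq_add_neg]
  rw [e1, e2, nk_const_mul hp _ _ ENNReal.ofReal_ne_top] at h
  change _ = _ * nk n p k (Phi n (-α - n / p)) at h
  have h' := congrArg (fun z => ENNReal.ofReal (((2 : ℝ) ^ k) ^ (α + n / p)) * z) h
  simp only [← mul_assoc] at h'
  rw [← ENNReal.ofReal_mul (by positivity), ← ENNReal.ofReal_mul (by positivity),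
    ← Real.rpow_add ht, ← Real.rpow_add ht] at h'
  have a1 : α + n / p + (-α - n / p) = 0 := by ring
  have a2 : α + n / p + -(n / p) = α := by ring
  rw [a1, a2] at h'
  unfold wk
  rw [← h']
  simp

theorem nk_zero_ne_top (n : ℕ) (p γ : ℝ) (hp : 1 < p) : nk n p 0 (Phi n γ) ≠ ⊤ := by
  unfold nk
  refine ENNReal.rpow_ne_top_of_nonneg (by positivity) ?_
  have hb : ∀ x ∈ annulus n 0, Phi n γ x ^ p ≤ ENNReal.ofReal (2 ^ |γ|) ^ p := by
    intro x hx
    refine ENNReal.rpow_le_rpow (ENNReal.ofReal_le_ofReal ?_) (by linarith)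
    obtain ⟨h1, h2⟩ := hx
    norm_num at h1 h2
    have hx0 : 0 < ‖x‖ := by linarith
    rcases le_total 0 γ with h | h
    · rw [abs_of_nonneg h]
      exact Real.rpow_le_rpow hx0.le (by linarith) h
    · rw [abs_of_nonpos h, Real.rpow_neg (by norm_num), ← Real.inv_rpow (by norm_num)]
      exact Real.rpow_le_rpow_of_nonpos (by norm_num) (by linarith) h
  refine ne_top_of_le_ne_top ?_ (setLIntegral_mono' (measurableSet_annulus n 0) hb)
  rw [setLIntegral_const]
  refine ENNReal.mul_ne_top (ENNReal.rpow_ne_top_of_nonneg (by linarith) ENNReal.ofReal_ne_top) ?_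
  refine ne_top_of_le_ne_top (measure_closedBall_lt_top (x := (0 : EuclideanSpace ℝ (Fin n)))
    (r := 1)).ne (measure_mono ?_)
  intro x hx
  simpa using hx.2

theorem nk_zero_ne_zero (n : ℕ) (hn : 1 ≤ n) (p γ : ℝ) (hp : 1 < p) :
    nk n p 0 (Phi n γ) ≠ 0 := by
  unfold nk
  rw [Ne, ENNReal.rpow_eq_zero_iff_of_pos (by positivity)]
  rw [← Ne, ← pos_iff_ne_zero, setLIntegral_pos_iff ((Phi_meas n γ).pow_const p)]
  have hU : IsOpen {x : EuclideanSpace ℝ (Fin n) | 1 / 2 < ‖x‖ ∧ ‖x‖ < 1} :=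
    (isOpen_lt continuous_const continuous_norm).inter (isOpen_lt continuous_norm continuous_const)
  haveI : Nonempty (Fin n) := ⟨⟨0, hn⟩⟩
  obtain ⟨y, hy⟩ := exists_norm_eq (EuclideanSpace ℝ (Fin n)) (c := 3 / 4) (by norm_num)
  refine (hU.measure_pos volume ⟨y, ?_⟩).trans_le (measure_mono ?_)
  · constructor <;> rw [hy] <;> norm_num
  · rintro x ⟨h1, h2⟩
    refine ⟨?_, ?_, ?_⟩
    · have : 0 < ‖x‖ := by linarith
      have h3 : 0 < Phi n γ x := ENNReal.ofReal_pos.2 (Real.rpow_pos_of_pos this _)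
      exact (ENNReal.rpow_pos h3 ENNReal.ofReal_ne_top).ne'
    · norm_num; linarith
    · norm_num; linarith

noncomputable def fL (n : ℕ) (γ : ℝ) (L : ℕ) : EuclideanSpace ℝ (Fin n) → ℝ :=
  {x | (2 : ℝ) ^ (-(L : ℤ)) < ‖x‖ ∧ ‖x‖ ≤ (2 : ℝ) ^ (L : ℤ)}.indicator fun x => ‖x‖ ^ γ

theorem fL_meas (n : ℕ) (γ : ℝ) (L : ℕ) : Measurable (fL n γ L) := by
  unfold fL
  refine Measurable.indicator (by fun_prop) ?_
  exact (measurableSet_lt measurable_const measurable_norm).inter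
    (measurableSet_le measurable_norm measurable_const)

theorem fL_nonneg (n : ℕ) (γ : ℝ) (L : ℕ) (x) : 0 ≤ fL n γ L x :=
  indicator_nonneg (fun x _ => by positivity) x

theorem fL_le (n : ℕ) (γ : ℝ) (L : ℕ) (x) : fL n γ L x ≤ ‖x‖ ^ γ :=
  indicator_le_self' (fun x _ => by positivity) x

theorem herz_fL (n : ℕ) (α p q : ℝ) (hp : 1 < p) (hq : 1 < q) (L : ℕ) :
    herzNorm n α p q (fL n (-α - n / p) L) ≤
      2 * (L : ℝ≥0∞) ^ (1 / q) * nk n p 0 (Phi n (-α - n / p)) := by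
  have hq0 : 0 < q := by linarith
  have hp0 : 0 < p := by linarith
  rw [herz_eq n α p q hq]
  unfold hnorm
  set A := nk n p 0 (Phi n (-α - n / p)) with hA
  have hz : ∀ k ∉ Finset.Ioc (-(L : ℤ)) L,
      (wk α k * nk n p k (fun x => ENNReal.ofReal |fL n (-α - n / p) L x|)) ^ q = 0 := by
    intro k hk
    have : nk n p k (fun x => ENNReal.ofReal |fL n (-α - n / p) L x|) = 0 := by
      unfold nk
      rw [ENNReal.rpow_eq_zero_iff_of_pos (by positivity)]
      refine setLIntegral_eq_zero (measurableSet_annulus n k) fun x hx => ?_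
      have : fL n (-α - n / p) L x = 0 := by
        refine indicator_of_notMem ?_ _
        rintro ⟨h1, h2⟩
        apply hk
        rw [Finset.mem_Ioc]
        constructor
        · exact (zpow_lt_zpow_iff_right₀ (_root_.one_lt_two (α := ℝ))).1 (h1.trans_le hx.2)
        · have := (zpow_lt_zpow_iff_right₀ (_root_.one_lt_two (α := ℝ))).1 (hx.1.trans_le h2)
          linarith
      simp [this, hp0]
    rw [this, mul_zero, ENNReal.zero_rpow_of_pos hq0]
  rw [tsum_eq_sum hz]
  have h1 : ∑ k ∈ Finset.Ioc (-(L : ℤ)) L,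
      (wk α k * nk n p k (fun x => ENNReal.ofReal |fL n (-α - n / p) L x|)) ^ q ≤
      ((2 * L : ℕ) : ℝ≥0∞) * A ^ q := by
    refine (Finset.sum_le_card_nsmul _ _ (A ^ q) fun k _ => ?_).trans ?_
    · refine ENNReal.rpow_le_rpow ?_ hq0.le
      rw [hA, ← wk_nk_Phi n α p hp k]
      gcongr
      refine nk_mono hp fun x _ => ENNReal.ofReal_le_ofReal ?_
      rw [abs_of_nonneg (fL_nonneg _ _ _ _)]
      exact fL_le _ _ _ _
    · rw [nsmul_eq_mul, Int.card_Ioc]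
      have : ((L : ℤ) - -(L : ℤ)).toNat = 2 * L := by omega
      rw [this]
  calc _ ≤ (((2 * L : ℕ) : ℝ≥0∞) * A ^ q) ^ (1 / q) := ENNReal.rpow_le_rpow h1 (by positivity)
    _ = (2 : ℝ≥0∞) ^ (1 / q) * (L : ℝ≥0∞) ^ (1 / q) * A := by
      push_cast
      rw [ENNReal.mul_rpow_of_nonneg _ _ (by positivity), ENNReal.mul_rpow_of_nonneg _ _ (by positivity),
          ← ENNReal.rpow_mul, mul_one_div_cancel hq0.ne', ENNReal.rpow_one]
    _ ≤ _ := by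
      gcongr
      calc (2 : ℝ≥0∞) ^ (1 / q) ≤ 2 ^ (1 : ℝ) :=
            ENNReal.rpow_le_rpow_of_exponent_le (by norm_num) ((div_le_one hq0).2 hq.le)
        _ = 2 := ENNReal.rpow_one _

theorem avg_fL (n : ℕ) (γ : ℝ) (ψ : ℝ → ℝ)
    (hψ : ∀ t ∈ Icc (0 : ℝ) 1, 0 ≤ ψ t) (hψm : Measurable ψ)
    (hfin : (∫⁻ t in Ioc (0 : ℝ) 1, ENNReal.ofReal (t ^ γ * ψ t)) < ⊤) (L : ℕ)
    (x : EuclideanSpace ℝ (Fin n)) (hx1 : 1 < ‖x‖) (hx2 : ‖x‖ ≤ 2 ^ (L : ℤ)) :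
    (∫⁻ t in Ioc ((2 : ℝ) ^ (-(L : ℤ))) 1, ENNReal.ofReal (t ^ γ * ψ t)) * Phi n γ x ≤
      ENNReal.ofReal |hardyLittlewoodAvg n ψ (fL n γ L) x| := by
  have hx0 : 0 < ‖x‖ := by linarith
  have hI : IntegrableOn (fun t => t ^ γ * ψ t) (Ioc (0 : ℝ) 1) := by
    refine ⟨(by fun_prop), ?_⟩
    rw [hasFiniteIntegral_iff_ofReal]
    · exact hfin
    · refine (ae_restrict_iff' measurableSet_Ioc).2 (ae_of_all _ fun t ht => ?_)
      exact mul_nonneg (Real.rpow_nonneg ht.1.le _) (hψ t ⟨ht.1.le, ht.2⟩)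
  have hnn : ∀ t ∈ Ioc (0 : ℝ) 1, 0 ≤ fL n γ L (t • x) * ψ t := fun t ht =>
    mul_nonneg (fL_nonneg _ _ _ _) (hψ t ⟨ht.1.le, ht.2⟩)
  have hns : ∀ t : ℝ, 0 < t → ‖t • x‖ ^ γ = ‖x‖ ^ γ * t ^ γ := by
    intro t ht
    rw [norm_smul, Real.norm_eq_abs, abs_of_pos ht, Real.mul_rpow ht.le hx0.le, mul_comm]
  have hI2 : IntegrableOn (fun t => fL n γ L (t • x) * ψ t) (Ioc (0 : ℝ) 1) := by
    refine Integrable.mono' (hI.const_mul (‖x‖ ^ γ)) ?_ ?_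
    · refine (Measurable.mul ?_ hψm).aestronglyMeasurable
      exact (fL_meas n γ L).comp (by fun_prop)
    · refine (ae_restrict_iff' measurableSet_Ioc).2 (ae_of_all _ fun t ht => ?_)
      rw [Real.norm_eq_abs, abs_of_nonneg (hnn t ht), ← mul_assoc, ← hns t ht.1]
      exact mul_le_mul_of_nonneg_right (fL_le _ _ _ _) (hψ t ⟨ht.1.le, ht.2⟩)
  have h0 : 0 ≤ᵐ[volume.restrict (Ioc (0 : ℝ) 1)] fun t => fL n γ L (t • x) * ψ t :=
    (ae_restrict_iff' measurableSet_Ioc).2 (ae_of_all _ fun t ht => hnn t ht)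
  unfold hardyLittlewoodAvg
  rw [abs_of_nonneg (integral_nonneg_of_ae h0), ofReal_integral_eq_lintegral_ofReal hI2 h0,
    ← lintegral_mul_const' _ _ (by simp [Phi])]
  have hL0 : (0 : ℝ) < 2 ^ (-(L : ℤ)) := by positivity
  refine le_trans ?_ (lintegral_mono_set (Ioc_subset_Ioc_left hL0.le))
  refine setLIntegral_mono' measurableSet_Ioc fun t ht => ?_
  have ht0 : 0 < t := hL0.trans ht.1
  unfold Phi
  rw [← ENNReal.ofReal_mul' (by positivity)]
  refine ENNReal.ofReal_le_ofReal (le_of_eq ?_)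
  have : fL n γ L (t • x) = ‖t • x‖ ^ γ := by
    refine indicator_of_mem (s := {x : EuclideanSpace ℝ (Fin n) | (2 : ℝ) ^ (-(L : ℤ)) < ‖x‖ ∧ ‖x‖ ≤ (2 : ℝ) ^ (L : ℤ)}) ⟨?_, ?_⟩ _
    · rw [norm_smul, Real.norm_eq_abs, abs_of_pos ht0]
      nlinarith [ht.1]
    · rw [norm_smul, Real.norm_eq_abs, abs_of_pos ht0]
      nlinarith [ht.2]
  rw [this, hns t ht0]
  ring

theorem herz_avg_fL (n : ℕ) (α p q : ℝ) (hp : 1 < p) (hq : 1 < q) (ψ : ℝ → ℝ)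
    (hψ : ∀ t ∈ Icc (0 : ℝ) 1, 0 ≤ ψ t) (hψm : Measurable ψ)
    (hfin : (∫⁻ t in Ioc (0 : ℝ) 1, ENNReal.ofReal (t ^ (-α - n / p) * ψ t)) < ⊤) (L : ℕ) :
    (L : ℝ≥0∞) ^ (1 / q) * ((∫⁻ t in Ioc ((2 : ℝ) ^ (-(L : ℤ))) 1,
      ENNReal.ofReal (t ^ (-α - n / p) * ψ t)) * nk n p 0 (Phi n (-α - n / p))) ≤
      herzNorm n α p q (hardyLittlewoodAvg n ψ (fL n (-α - n / p) L)) := by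
  have hq0 : 0 < q := by linarith
  rw [herz_eq n α p q hq]
  unfold hnorm
  set I := ∫⁻ t in Ioc ((2 : ℝ) ^ (-(L : ℤ))) 1, ENNReal.ofReal (t ^ (-α - n / p) * ψ t) with hI
  set A := nk n p 0 (Phi n (-α - n / p)) with hA
  have hIt : I ≠ ⊤ := by
    refine ne_top_of_le_ne_top hfin.ne (lintegral_mono_set (Ioc_subset_Ioc_left (by positivity)))
  have h1 : (L : ℝ≥0∞) * (I * A) ^ q ≤ ∑' k : ℤ, (wk α k * nk n p k (fun x =>
      ENNReal.ofReal |hardyLittlewoodAvg n ψ (fL n (-α - n / p) L) x|)) ^ q := by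
    refine le_trans ?_ (ENNReal.sum_le_tsum (Finset.Ioc (0 : ℤ) L))
    refine le_trans ?_ (Finset.card_nsmul_le_sum _ _ ((I * A) ^ q) fun k hk => ?_)
    · rw [nsmul_eq_mul, Int.card_Ioc]; simp
    · rw [Finset.mem_Ioc] at hk
      refine ENNReal.rpow_le_rpow ?_ hq0.le
      rw [hA, ← wk_nk_Phi n α p hp k, mul_left_comm, ← nk_const_mul hp _ _ hIt]
      gcongr
      refine nk_mono hp fun x hx => ?_
      refine avg_fL n _ ψ hψ hψm hfin L x ?_ ?_
      · refine lt_of_le_of_lt ?_ hx.1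
        exact one_le_zpow₀ one_le_two (by omega)
      · exact hx.2.trans (zpow_le_zpow_right₀ one_le_two hk.2)
  calc _ = ((L : ℝ≥0∞) * (I * A) ^ q) ^ (1 / q) := by
        rw [ENNReal.mul_rpow_of_nonneg _ _ (by positivity),
          ← ENNReal.rpow_mul, mul_one_div_cancel hq0.ne', ENNReal.rpow_one]
    _ ≤ _ := ENNReal.rpow_le_rpow h1 (by positivity)

theorem lower_L (n : ℕ) (hn : 1 ≤ n) (α p q : ℝ) (hp : 1 < p) (hq : 1 < q) (ψ : ℝ → ℝ)
    (hψ : ∀ t ∈ Icc (0 : ℝ) 1, 0 ≤ ψ t) (hψm : Measurable ψ)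
    (hfin : (∫⁻ t in Ioc (0 : ℝ) 1, ENNReal.ofReal (t ^ (-α - n / p) * ψ t)) < ⊤) (D : ℝ≥0∞)
    (hD : ∀ f : EuclideanSpace ℝ (Fin n) → ℝ, Measurable f → herzNorm n α p q f < ⊤ →
            herzNorm n α p q (hardyLittlewoodAvg n ψ f) ≤ D * herzNorm n α p q f)
    (L : ℕ) (hL : L ≠ 0) :
    (∫⁻ t in Ioc ((2 : ℝ) ^ (-(L : ℤ))) 1, ENNReal.ofReal (t ^ (-α - n / p) * ψ t)) ≤ 2 * D := by
  have hq0 : 0 < q := by linarith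
  have h1 := herz_fL n α p q hp hq L
  have h2 := herz_avg_fL n α p q hp hq ψ hψ hψm hfin L
  have hA0 := nk_zero_ne_zero n hn p (-α - n / p) hp
  have hAt := nk_zero_ne_top n p (-α - n / p) hp
  set A := nk n p 0 (Phi n (-α - n / p)) with hA
  have hLt : (L : ℝ≥0∞) ^ (1 / q) ≠ ⊤ :=
    ENNReal.rpow_ne_top_of_nonneg (by positivity) (by simp)
  have hL0 : (L : ℝ≥0∞) ^ (1 / q) ≠ 0 :=
    (ENNReal.rpow_pos (by simpa [pos_iff_ne_zero] using hL) (by simp)).ne'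
  have hBt : (L : ℝ≥0∞) ^ (1 / q) * A ≠ ⊤ := ENNReal.mul_ne_top hLt hAt
  have hB0 : (L : ℝ≥0∞) ^ (1 / q) * A ≠ 0 := mul_ne_zero hL0 hA0
  have h3 := hD _ (fL_meas n (-α - n / p) L) (h1.trans_lt (by
    rw [mul_assoc]; exact ENNReal.mul_lt_top (by simp) hBt.lt_top))
  have h4 := (h2.trans h3).trans (mul_le_mul_right h1 D)
  refine (ENNReal.mul_le_mul_iff_left hB0 hBt).1 ?_
  calc _ = _ := by ring
    _ ≤ _ := h4
    _ = _ := by ring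

theorem lower (n : ℕ) (hn : 1 ≤ n) (α p q : ℝ) (hp : 1 < p) (hq : 1 < q) (ψ : ℝ → ℝ)
    (hψ : ∀ t ∈ Icc (0 : ℝ) 1, 0 ≤ ψ t) (hψm : Measurable ψ)
    (hfin : (∫⁻ t in Ioc (0 : ℝ) 1, ENNReal.ofReal (t ^ (-α - n / p) * ψ t)) < ⊤) (D : ℝ≥0∞)
    (hD : ∀ f : EuclideanSpace ℝ (Fin n) → ℝ, Measurable f → herzNorm n α p q f < ⊤ →
            herzNorm n α p q (hardyLittlewoodAvg n ψ f) ≤ D * herzNorm n α p q f) :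
    (∫⁻ t in Ioc (0 : ℝ) 1, ENNReal.ofReal (t ^ (-α - n / p) * ψ t)) ≤ 2 * D := by
  have hU : Ioc (0 : ℝ) 1 = ⋃ L : ℕ, Ioc ((2 : ℝ) ^ (-((L + 1 : ℕ) : ℤ))) 1 := by
    ext t
    simp only [mem_iUnion, mem_Ioc]
    constructor
    · rintro ⟨h0, h1⟩
      obtain ⟨L, hL⟩ := exists_pow_lt_of_lt_one h0 (show (1 / 2 : ℝ) < 1 by norm_num)
      refine ⟨L, lt_of_le_of_lt ?_ hL, h1⟩
      rw [zpow_neg, zpow_natCast, one_div, inv_pow]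
      gcongr
      · norm_num
      · omega
    · rintro ⟨L, h0, h1⟩
      exact ⟨lt_trans (by positivity) h0, h1⟩
  have hmono : Monotone fun L : ℕ => Ioc ((2 : ℝ) ^ (-((L + 1 : ℕ) : ℤ))) 1 := by
    intro L M hLM
    refine Ioc_subset_Ioc_left (zpow_le_zpow_right₀ one_le_two ?_)
    push_cast
    omega
  rw [hU, setLIntegral_iUnion_of_directed _ hmono.directed_le]
  exact iSup_le fun L => lower_L n hn α p q hp hq ψ hψ hψm hfin D hD (L + 1) (by omega)

/-- If `∫₀¹ t^{-α-n/p} ψ(t) dt < ∞` then `U_ψ` is bounded on the homogeneous Herz space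
`K̇^{α,q}_p(ℝⁿ)`, with operator norm comparable (with constants independent of `ψ`) to
`∫₀¹ t^{-α-n/p} ψ(t) dt`. -/
theorem hardyLittlewoodAvg_herz (n : ℕ) (hn : 1 ≤ n) (α p q : ℝ)
    (hp : 1 < p) (hq : 1 < q) :
    ∃ c C : ℝ≥0∞, 0 < c ∧ C < ⊤ ∧
      ∀ ψ : ℝ → ℝ, (∀ t ∈ Icc (0 : ℝ) 1, 0 ≤ ψ t) → Measurable ψ →
        (∫⁻ t in Ioc (0 : ℝ) 1, ENNReal.ofReal (t ^ (-α - n / p) * ψ t)) < ⊤ →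
        (∀ f : EuclideanSpace ℝ (Fin n) → ℝ, Measurable f → herzNorm n α p q f < ⊤ →
          herzNorm n α p q (hardyLittlewoodAvg n ψ f)
            ≤ C * (∫⁻ t in Ioc (0 : ℝ) 1, ENNReal.ofReal (t ^ (-α - n / p) * ψ t)) *
              herzNorm n α p q f) ∧
        (∀ D : ℝ≥0∞,
          (∀ f : EuclideanSpace ℝ (Fin n) → ℝ, Measurable f → herzNorm n α p q f < ⊤ →
            herzNorm n α p q (hardyLittlewoodAvg n ψ f) ≤ D * herzNorm n α p q f) →
          c * (∫⁻ t in Ioc (0 : ℝ) 1, ENNReal.ofReal (t ^ (-α - n / p) * ψ t)) ≤ D) := by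
  refine ⟨2⁻¹, ENNReal.ofReal (2 * 2 ^ |α|), by simp, ENNReal.ofReal_lt_top, ?_⟩
  intro ψ hψ hψm hfin
  refine ⟨fun f hf _ => upper n α p q hp hq ψ hψ hψm f hf, fun D hD => ?_⟩
  have h := lower n hn α p q hp hq ψ hψ hψm hfin D hD
  calc _ ≤ 2⁻¹ * (2 * D) := by gcongr
    _ = D := by
      rw [← mul_assoc, ENNReal.inv_mul_cancel (by norm_num) (by norm_num), one_mul]
end

section
/- Let ψ : [0,1] → [0,∞), α ∈ ℝ, λ > 0, 1 < p, q, p̃ < ∞, and suppose ∫₀¹ t^{−α−n/p+λ} ψ(t) dt < ∞. Then U_ψ f(x) = ∫₀¹ f(tx)ψ(t) dt is bounded on the mixed radial-angular homogeneous Morrey–Herz space MK̇^{α,q,λ}_{L^p_{rad}L^{p̃}_{ang}}(ℝⁿ), with operator norm comparable to ∫₀¹ t^{−α−n/p+λ} ψ(t) dt. -/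
open MeasureTheory Set ENNReal Metric

/-- The mixed radial-angular `L^p_{rad}L^{pt}_{ang}` norm of `f χ_{C_k}` on the annulus
`C_k = {2^{k-1} < |x| ≤ 2^k}`. -/
noncomputable def mixedAnnNorm (n : ℕ) (p pt : ℝ) (k : ℤ)
    (f : EuclideanSpace ℝ (Fin n) → ℝ) : ℝ≥0∞ :=
  (∫⁻ r in Ioc ((2 : ℝ) ^ (k - 1)) ((2 : ℝ) ^ k),
    (∫⁻ θ : sphere (0 : EuclideanSpace ℝ (Fin n)) 1,
        ENNReal.ofReal |f (r • (θ : EuclideanSpace ℝ (Fin n)))| ^ pt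
      ∂(sphereMeasure n)) ^ (p / pt) *
      ENNReal.ofReal (r ^ ((n : ℝ) - 1))) ^ (1 / p)

/-- The mixed radial-angular homogeneous Morrey–Herz norm
`sup_{k₀∈ℤ} 2^{-k₀λ} (Σ_{k≤k₀} 2^{kαq} ‖fχ_k‖^q_{L^p_{rad}L^{pt}_{ang}})^{1/q}`. -/
noncomputable def morreyHerzNorm (n : ℕ) (α q lam p pt : ℝ)
    (f : EuclideanSpace ℝ (Fin n) → ℝ) : ℝ≥0∞ :=
  ⨆ k₀ : ℤ, ENNReal.ofReal (((2 : ℝ) ^ k₀) ^ (-lam)) *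
    (∑' k : ℤ, if k ≤ k₀ then
        ENNReal.ofReal (((2 : ℝ) ^ k) ^ (α * q)) * (mixedAnnNorm n p pt k f) ^ q
      else 0) ^ (1 / q)

theorem minkowski_lint {X T : Type*} [MeasurableSpace X] [MeasurableSpace T]
    (μ : Measure X) (ν : Measure T) [SFinite μ] [SFinite ν] (F : X → T → ℝ≥0∞)
    (hF : Measurable (Function.uncurry F)) (r : ℝ) (hr : 1 < r) :
    (∫⁻ x, (∫⁻ t, F x t ∂ν) ^ r ∂μ) ^ (1 / r) ≤ ∫⁻ t, (∫⁻ x, F x t ^ r ∂μ) ^ (1 / r) ∂ν := by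
  have hr0 : 0 < r := by linarith
  set A : T → ℝ≥0∞ := fun t => (∫⁻ x, F x t ^ r ∂μ) ^ (1 / r) with hA
  have hFr : Measurable (Function.uncurry fun x t => F x t ^ r) := hF.pow_const r
  have hAm : Measurable A := (Measurable.lintegral_prod_left hFr).pow_const _
  have hAr : ∀ t, A t ^ r = ∫⁻ x, F x t ^ r ∂μ := by
    intro t
    rw [hA]
    simp only
    rw [← ENNReal.rpow_mul, one_div_mul_cancel hr0.ne', ENNReal.rpow_one]
  by_cases hAtop : ∫⁻ t, A t ∂ν = ⊤
  · rw [hAtop]; exact le_top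
  have hAfin : ∀ᵐ t ∂ν, A t < ⊤ := ae_lt_top hAm hAtop
  have hset : MeasurableSet {z : X × T | A z.2 = 0 → F z.1 z.2 = 0} := by
    have h1 : MeasurableSet {z : X × T | A z.2 = 0} :=
      (hAm.comp measurable_snd) (measurableSet_singleton 0)
    have h2 : MeasurableSet {z : X × T | F z.1 z.2 = 0} := hF (measurableSet_singleton 0)
    exact h1.imp h2
  have hzero : ∀ᵐ x ∂μ, ∀ᵐ t ∂ν, A t = 0 → F x t = 0 := by
    rw [Measure.ae_ae_comm hset]
    refine Filter.Eventually.of_forall fun t => ?_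
    by_cases h0 : A t = 0
    · have h1 := hAr t
      rw [h0, ENNReal.zero_rpow_of_pos hr0, eq_comm,
        lintegral_eq_zero_iff (by exact hFr.comp measurable_prodMk_right)] at h1
      filter_upwards [h1] with x hx _
      simpa [hr0, hr0.not_gt] using hx
    · exact Filter.Eventually.of_forall fun x h => absurd h h0
  have hconj : r.HolderConjugate (r / (r - 1)) := Real.HolderConjugate.conjExponent hr
  set s := r / (r - 1) with hs
  have hs0 : 0 < s := div_pos hr0 (by linarith)
  have hpt : ∀ᵐ x ∂μ, (∫⁻ t, F x t ∂ν) ^ r ≤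
      (∫⁻ t, A t ∂ν) ^ (r - 1) * ∫⁻ t, F x t ^ r * A t ^ (1 - r) ∂ν := by
    filter_upwards [hzero] with x hx
    have hFx : Measurable (fun t => F x t) := hF.comp measurable_prodMk_left
    have h1 : ∫⁻ t, F x t ∂ν =
        ∫⁻ t, ((fun t => F x t * A t ^ (-(1 / s))) * fun t => A t ^ (1 / s)) t ∂ν := by
      refine lintegral_congr_ae ?_
      filter_upwards [hx, hAfin] with t h0 hfin
      by_cases hz : A t = 0
      · simp [h0 hz]
      · simp only [Pi.mul_apply]
        rw [mul_assoc, ← ENNReal.rpow_add _ _ hz hfin.ne]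
        simp
    have h2 := ENNReal.lintegral_mul_le_Lp_mul_Lq ν hconj
      (f := fun t => F x t * A t ^ (-(1 / s))) (g := fun t => A t ^ (1 / s))
      (hFx.mul (hAm.pow_const _)).aemeasurable (hAm.pow_const _).aemeasurable
    rw [← h1] at h2
    calc (∫⁻ t, F x t ∂ν) ^ r ≤ _ := ENNReal.rpow_le_rpow h2 hr0.le
      _ = (∫⁻ t, A t ∂ν) ^ (r - 1) * ∫⁻ t, F x t ^ r * A t ^ (1 - r) ∂ν := by
        rw [ENNReal.mul_rpow_of_nonneg _ _ hr0.le, ← ENNReal.rpow_mul, ← ENNReal.rpow_mul,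
          one_div_mul_cancel hr0.ne', ENNReal.rpow_one, mul_comm]
        have hr1 : r - 1 ≠ 0 := by linarith
        have e1 : 1 / s * r = r - 1 := by
          rw [hs]; field_simp
        have e2 : -(1 / s) * r = 1 - r := by linarith
        rw [e1]
        congr 2
        · refine lintegral_congr fun t => ?_
          rw [← ENNReal.rpow_mul, one_div_mul_cancel hs0.ne', ENNReal.rpow_one]
        · ext t
          rw [ENNReal.mul_rpow_of_nonneg _ _ hr0.le, ← ENNReal.rpow_mul, e2]
  have hmain : ∫⁻ x, (∫⁻ t, F x t ∂ν) ^ r ∂μ ≤ (∫⁻ t, A t ∂ν) ^ r := by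
    have hm : Measurable (Function.uncurry fun x t => F x t ^ r * A t ^ (1 - r)) :=
      hFr.mul ((hAm.comp measurable_snd).pow_const _)
    calc _ ≤ ∫⁻ x, (∫⁻ t, A t ∂ν) ^ (r - 1) * ∫⁻ t, F x t ^ r * A t ^ (1 - r) ∂ν ∂μ :=
          lintegral_mono_ae hpt
      _ = (∫⁻ t, A t ∂ν) ^ (r - 1) * ∫⁻ x, ∫⁻ t, F x t ^ r * A t ^ (1 - r) ∂ν ∂μ :=
          lintegral_const_mul _ hm.lintegral_prod_right
      _ = (∫⁻ t, A t ∂ν) ^ (r - 1) * ∫⁻ t, ∫⁻ x, F x t ^ r * A t ^ (1 - r) ∂μ ∂ν := by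
          rw [lintegral_lintegral_swap hm.aemeasurable]
      _ ≤ (∫⁻ t, A t ∂ν) ^ (r - 1) * ∫⁻ t, A t ∂ν := by
          refine mul_le_mul_right (lintegral_mono fun t => ?_) _
          rw [lintegral_mul_const _ (by exact hFr.comp measurable_prodMk_right), ← hAr]
          by_cases h0 : A t = 0
          · simp [h0, hr0]
          by_cases h1 : A t = ⊤
          · simp [h1]
          rw [← ENNReal.rpow_add _ _ h0 h1]
          simp
      _ = (∫⁻ t, A t ∂ν) ^ r := by
          conv_lhs => rw [← ENNReal.rpow_one (∫⁻ t, A t ∂ν), ← ENNReal.rpow_mul, one_mul,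
            ← ENNReal.rpow_add_of_nonneg _ _ (by linarith) zero_le_one]
          simp
  calc _ ≤ ((∫⁻ t, A t ∂ν) ^ r) ^ (1 / r) := ENNReal.rpow_le_rpow hmain (by positivity)
    _ = _ := by rw [← ENNReal.rpow_mul, mul_one_div_cancel hr0.ne', ENNReal.rpow_one]

instance sphereMeasure_finite (n : ℕ) : IsFiniteMeasure (sphereMeasure n) := by
  unfold sphereMeasure; infer_instance

/-- Mixed norm of an extended nonnegative function on the annulus `a < |x| ≤ b`. -/
noncomputable def mixI (n : ℕ) (p pt : ℝ) (a b : ℝ)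
    (G : EuclideanSpace ℝ (Fin n) → ℝ≥0∞) : ℝ≥0∞ :=
  (∫⁻ r in Ioc a b,
    (∫⁻ θ : sphere (0 : EuclideanSpace ℝ (Fin n)) 1,
        G (r • (θ : EuclideanSpace ℝ (Fin n))) ^ pt
      ∂(sphereMeasure n)) ^ (p / pt) *
      ENNReal.ofReal (r ^ ((n : ℝ) - 1))) ^ (1 / p)

theorem mixI_mono (n : ℕ) (p pt : ℝ) (hp : 1 < p) (hpt : 1 < pt) (a b : ℝ)
    {G H : EuclideanSpace ℝ (Fin n) → ℝ≥0∞} (h : ∀ x, G x ≤ H x) :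
    mixI n p pt a b G ≤ mixI n p pt a b H := by
  have hp0 : 0 < p := by linarith
  have hpt0 : 0 < pt := by linarith
  unfold mixI
  gcongr
  exact h _

theorem mixI_const_mul (n : ℕ) (p pt : ℝ) (hp : 1 < p) (hpt : 1 < pt) (a b : ℝ) (ha : 0 ≤ a)
    (c : ℝ≥0∞) (hc : c ≠ ⊤) {G H : EuclideanSpace ℝ (Fin n) → ℝ≥0∞}
    (h : ∀ x, x ≠ 0 → G x = c * H x) :
    mixI n p pt a b G = c * mixI n p pt a b H := by
  have hp0 : 0 < p := by linarith
  have hpt0 : 0 < pt := by linarith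
  unfold mixI
  have h1 : ∀ r ∈ Ioc a b, (∫⁻ θ : sphere (0 : EuclideanSpace ℝ (Fin n)) 1,
        G (r • (θ : EuclideanSpace ℝ (Fin n))) ^ pt ∂(sphereMeasure n)) ^ (p / pt) *
        ENNReal.ofReal (r ^ ((n : ℝ) - 1)) =
      c ^ p * ((∫⁻ θ : sphere (0 : EuclideanSpace ℝ (Fin n)) 1,
        H (r • (θ : EuclideanSpace ℝ (Fin n))) ^ pt ∂(sphereMeasure n)) ^ (p / pt) *
        ENNReal.ofReal (r ^ ((n : ℝ) - 1))) := by
    intro r hr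
    have hr0 : r ≠ 0 := (ha.trans_lt hr.1).ne'
    have h2 : ∀ θ : sphere (0 : EuclideanSpace ℝ (Fin n)) 1,
        G (r • (θ : EuclideanSpace ℝ (Fin n))) ^ pt =
        c ^ pt * H (r • (θ : EuclideanSpace ℝ (Fin n))) ^ pt := by
      intro θ
      rw [h _ (smul_ne_zero hr0 (ne_zero_of_mem_unit_sphere θ)),
        ENNReal.mul_rpow_of_nonneg _ _ hpt0.le]
    simp_rw [h2]
    rw [lintegral_const_mul' _ _ (ENNReal.rpow_ne_top_of_nonneg hpt0.le hc),
      ENNReal.mul_rpow_of_nonneg _ _ (by positivity), ← ENNReal.rpow_mul,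
      mul_div_cancel₀ _ hpt0.ne', mul_assoc]
  rw [setLIntegral_congr_fun measurableSet_Ioc h1,
    lintegral_const_mul' _ _ (ENNReal.rpow_ne_top_of_nonneg hp0.le hc),
    ENNReal.mul_rpow_of_nonneg _ _ (by positivity), ← ENNReal.rpow_mul,
      mul_one_div_cancel hp0.ne', ENNReal.rpow_one]

theorem lint_scale (s a b : ℝ) (hs : 0 < s) (H : ℝ → ℝ≥0∞) :
    ∫⁻ r in Ioc a b, H (s * r) = ENNReal.ofReal s⁻¹ * ∫⁻ r in Ioc (s * a) (s * b), H r := by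
  rw [← lintegral_indicator measurableSet_Ioc, ← lintegral_indicator measurableSet_Ioc]
  have h := Real.map_volume_mul_left hs.ne'
  rw [abs_of_pos (inv_pos.2 hs)] at h
  rw [← smul_eq_mul, ← lintegral_smul_measure, ← h]
  have h2 := lintegral_map_equiv (μ := (volume : Measure ℝ)) ((Ioc (s * a) (s * b)).indicator H)
    (MeasurableEquiv.mulLeft₀ s hs.ne')
  have h3 : (⇑(MeasurableEquiv.mulLeft₀ s hs.ne') : ℝ → ℝ) = fun x => s * x := rfl
  rw [h3] at h2
  rw [h2]
  refine lintegral_congr fun r => ?_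
  simp only [indicator, mem_Ioc, mul_lt_mul_iff_right₀ hs, mul_le_mul_iff_right₀ hs]

theorem mixI_scale (n : ℕ) (p pt : ℝ) (hp : 1 < p) (s a b : ℝ) (hs : 0 < s)
    (ha : 0 ≤ a) (G : EuclideanSpace ℝ (Fin n) → ℝ≥0∞) :
    mixI n p pt a b (fun x => G (s • x)) =
      ENNReal.ofReal (s ^ (-(n / p) : ℝ)) * mixI n p pt (s * a) (s * b) G := by
  have hp0 : 0 < p := by linarith
  unfold mixI
  have hn : ENNReal.ofReal (s ^ (1 - n : ℝ)) ≠ ⊤ := ENNReal.ofReal_ne_top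
  have h1 : ∀ r ∈ Ioc a b, (∫⁻ θ : sphere (0 : EuclideanSpace ℝ (Fin n)) 1,
        G (s • r • (θ : EuclideanSpace ℝ (Fin n))) ^ pt ∂(sphereMeasure n)) ^ (p / pt) *
        ENNReal.ofReal (r ^ ((n : ℝ) - 1)) =
      (fun ρ => ENNReal.ofReal (s ^ (1 - n : ℝ)) *
       ((∫⁻ θ : sphere (0 : EuclideanSpace ℝ (Fin n)) 1,
        G (ρ • (θ : EuclideanSpace ℝ (Fin n))) ^ pt ∂(sphereMeasure n)) ^ (p / pt) *
        ENNReal.ofReal (ρ ^ ((n : ℝ) - 1)))) (s * r) := by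
    intro r hr
    have hr0 : 0 < r := (ha.trans_lt hr.1)
    have e : r ^ ((n : ℝ) - 1) = s ^ (1 - n : ℝ) * (s * r) ^ ((n : ℝ) - 1) := by
      rw [Real.mul_rpow hs.le hr0.le, ← mul_assoc, ← Real.rpow_add hs]
      simp
    simp only [smul_smul]
    rw [e, ENNReal.ofReal_mul (by positivity)]
    ring
  have h5 := (setLIntegral_congr_fun (μ := volume) measurableSet_Ioc h1).trans
    (lint_scale s a b hs
    (fun ρ => ENNReal.ofReal (s ^ (1 - n : ℝ)) *
       ((∫⁻ θ : sphere (0 : EuclideanSpace ℝ (Fin n)) 1,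
        G (ρ • (θ : EuclideanSpace ℝ (Fin n))) ^ pt ∂(sphereMeasure n)) ^ (p / pt) *
        ENNReal.ofReal (ρ ^ ((n : ℝ) - 1)))))
  rw [h5, lintegral_const_mul' _ _ hn, ← mul_assoc, ENNReal.mul_rpow_of_nonneg _ _ (by positivity)]
  congr 1
  rw [← ENNReal.ofReal_mul (by positivity), ENNReal.ofReal_rpow_of_pos (by positivity),
    ← Real.rpow_neg_one, ← Real.rpow_add hs, ← Real.rpow_mul hs.le]
  congr 2
  field_simp
  ring

theorem mixI_minkowski (n : ℕ) (p pt : ℝ) (hp : 1 < p) (hpt : 1 < pt) (a b : ℝ)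
    (ν : Measure ℝ) [SFinite ν] (F : EuclideanSpace ℝ (Fin n) → ℝ → ℝ≥0∞)
    (hF : Measurable (Function.uncurry F)) :
    mixI n p pt a b (fun x => ∫⁻ t, F x t ∂ν) ≤ ∫⁻ t, mixI n p pt a b (fun x => F x t) ∂ν := by
  have hp0 : 0 < p := by linarith
  have hpt0 : 0 < pt := by linarith
  set μ : Measure ℝ := (volume.restrict (Ioc a b)).withDensity
    (fun r => ENNReal.ofReal (r ^ ((n : ℝ) - 1))) with hμ
  have hw : Measurable (fun r : ℝ => ENNReal.ofReal (r ^ ((n : ℝ) - 1))) := by fun_prop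
  have key : ∀ G : EuclideanSpace ℝ (Fin n) → ℝ≥0∞, mixI n p pt a b G =
      (∫⁻ r, ((∫⁻ θ : sphere (0 : EuclideanSpace ℝ (Fin n)) 1,
        G (r • (θ : EuclideanSpace ℝ (Fin n))) ^ pt ∂(sphereMeasure n)) ^ (1 / pt)) ^ p ∂μ)
        ^ (1 / p) := by
    intro G
    rw [hμ, lintegral_withDensity_eq_lintegral_mul_non_measurable _ hw
      (Filter.Eventually.of_forall fun _ => ENNReal.ofReal_lt_top)]
    unfold mixI
    congr 2
    ext r
    simp only [Pi.mul_apply]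
    rw [← ENNReal.rpow_mul, mul_comm, one_div_mul_eq_div]
  simp_rw [key]
  set B : ℝ → ℝ → ℝ≥0∞ := fun r t => (∫⁻ θ : sphere (0 : EuclideanSpace ℝ (Fin n)) 1,
        F (r • (θ : EuclideanSpace ℝ (Fin n))) t ^ pt ∂(sphereMeasure n)) ^ (1 / pt) with hB
  have hBm : Measurable (Function.uncurry B) := by
    refine Measurable.pow_const (Measurable.lintegral_prod_right'
      (f := fun z : (ℝ × ℝ) × sphere (0 : EuclideanSpace ℝ (Fin n)) 1 =>
        F (z.1.1 • (z.2 : EuclideanSpace ℝ (Fin n))) z.1.2 ^ pt) ?_) _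
    refine Measurable.pow_const (hF.comp (Measurable.prodMk ?_ ?_)) _ <;> fun_prop
  refine le_trans ?_ (minkowski_lint μ ν B hBm p hp)
  gcongr with r
  refine minkowski_lint (sphereMeasure n) ν
    (fun θ t => F (r • (θ : EuclideanSpace ℝ (Fin n))) t) ?_ pt hpt
  refine hF.comp (Measurable.prodMk ?_ ?_) <;> fun_prop

theorem mixI_measurable (n : ℕ) (p pt : ℝ) (a b : ℝ)
    (F : EuclideanSpace ℝ (Fin n) → ℝ → ℝ≥0∞)
    (hF : Measurable (Function.uncurry F)) :
    Measurable fun t => mixI n p pt a b (fun x => F x t) := by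
  unfold mixI
  refine Measurable.pow_const (Measurable.lintegral_prod_right'
      (f := fun z : ℝ × ℝ => (∫⁻ θ : sphere (0 : EuclideanSpace ℝ (Fin n)) 1,
        F (z.2 • (θ : EuclideanSpace ℝ (Fin n))) z.1 ^ pt
      ∂(sphereMeasure n)) ^ (p / pt) *
      ENNReal.ofReal (z.2 ^ ((n : ℝ) - 1))) ?_) _
  refine Measurable.mul ?_ (by fun_prop)
  refine Measurable.pow_const (Measurable.lintegral_prod_right'
      (f := fun z : (ℝ × ℝ) × sphere (0 : EuclideanSpace ℝ (Fin n)) 1 =>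
        F (z.1.2 • (z.2 : EuclideanSpace ℝ (Fin n))) z.1.1 ^ pt) ?_) _
  refine Measurable.pow_const (hF.comp (Measurable.prodMk ?_ ?_)) _ <;> fun_prop

theorem mixI_union (n : ℕ) (p pt : ℝ) (hp : 1 < p) {a b a' c' b' : ℝ}
    (h : Ioc a b ⊆ Ioc a' c' ∪ Ioc c' b') (G : EuclideanSpace ℝ (Fin n) → ℝ≥0∞) :
    mixI n p pt a b G ≤ mixI n p pt a' c' G + mixI n p pt c' b' G := by
  have hp0 : 0 < p := by linarith
  unfold mixI
  refine le_trans ?_ (ENNReal.rpow_add_le_add_rpow _ _ (by positivity)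
    (by rw [div_le_one hp0]; exact hp.le))
  gcongr
  exact (lintegral_mono_set h).trans (lintegral_union_le _ _ _)

/-- The truncated dyadic weight. -/
noncomputable def cc (α : ℝ) (k₀ k : ℤ) : ℝ≥0∞ :=
  if k ≤ k₀ then ENNReal.ofReal (((2 : ℝ) ^ k) ^ α) else 0

/-- The truncated Herz norm. -/
noncomputable def TT (n : ℕ) (α q p pt : ℝ) (k₀ : ℤ)
    (G : EuclideanSpace ℝ (Fin n) → ℝ≥0∞) : ℝ≥0∞ :=
  (∑' k : ℤ, (cc α k₀ k * mixI n p pt ((2 : ℝ) ^ (k - 1)) ((2 : ℝ) ^ k) G) ^ q) ^ (1 / q)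

theorem morreyHerzNorm_eq (n : ℕ) (α q lam p pt : ℝ) (hq : 1 < q)
    (f : EuclideanSpace ℝ (Fin n) → ℝ) :
    morreyHerzNorm n α q lam p pt f = ⨆ k₀ : ℤ, ENNReal.ofReal (((2 : ℝ) ^ k₀) ^ (-lam)) *
      TT n α q p pt k₀ (fun x => ENNReal.ofReal |f x|) := by
  have hq0 : 0 < q := by linarith
  unfold morreyHerzNorm TT
  congr 1
  ext k₀
  congr 3
  ext k
  unfold cc
  split_ifs
  · have h2 : (0 : ℝ) < 2 ^ k := by positivity
    rw [ENNReal.mul_rpow_of_nonneg _ _ hq0.le, ENNReal.ofReal_rpow_of_pos (by positivity),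
      ← Real.rpow_mul h2.le]
    rfl
  · simp [hq0]

theorem TT_mono (n : ℕ) (α q p pt : ℝ) (hp : 1 < p) (hpt : 1 < pt) (hq : 1 < q) (k₀ : ℤ)
    {G H : EuclideanSpace ℝ (Fin n) → ℝ≥0∞} (h : ∀ x, G x ≤ H x) :
    TT n α q p pt k₀ G ≤ TT n α q p pt k₀ H := by
  have hq0 : 0 < q := by linarith
  unfold TT
  have := fun a b => mixI_mono n p pt hp hpt a b h
  gcongr
  exact this _ _

theorem TT_const_mul (n : ℕ) (α q p pt : ℝ) (hp : 1 < p) (hpt : 1 < pt) (hq : 1 < q) (k₀ : ℤ)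
    (c : ℝ≥0∞) (hc : c ≠ ⊤) {G H : EuclideanSpace ℝ (Fin n) → ℝ≥0∞}
    (h : ∀ x, x ≠ 0 → G x = c * H x) :
    TT n α q p pt k₀ G = c * TT n α q p pt k₀ H := by
  have hq0 : 0 < q := by linarith
  unfold TT
  have h1 : ∀ k : ℤ, (cc α k₀ k * mixI n p pt ((2 : ℝ) ^ (k - 1)) ((2 : ℝ) ^ k) G) ^ q =
      c ^ q * (cc α k₀ k * mixI n p pt ((2 : ℝ) ^ (k - 1)) ((2 : ℝ) ^ k) H) ^ q := by
    intro k
    rw [mixI_const_mul n p pt hp hpt _ _ (by positivity) c hc h, mul_left_comm,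
      ENNReal.mul_rpow_of_nonneg _ _ hq0.le]
  simp_rw [h1]
  rw [ENNReal.tsum_mul_left, ENNReal.mul_rpow_of_nonneg _ _ (by positivity), ← ENNReal.rpow_mul,
      mul_one_div_cancel hq0.ne', ENNReal.rpow_one]

theorem TT_minkowski (n : ℕ) (α q p pt : ℝ) (hp : 1 < p) (hpt : 1 < pt) (hq : 1 < q) (k₀ : ℤ)
    (ν : Measure ℝ) [SFinite ν] (F : EuclideanSpace ℝ (Fin n) → ℝ → ℝ≥0∞)
    (hF : Measurable (Function.uncurry F)) :
    TT n α q p pt k₀ (fun x => ∫⁻ t, F x t ∂ν) ≤ ∫⁻ t, TT n α q p pt k₀ (fun x => F x t) ∂ν := by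
  have hq0 : 0 < q := by linarith
  unfold TT
  simp_rw [← lintegral_count]
  have hm := fun k : ℤ => mixI_measurable n p pt ((2 : ℝ) ^ (k - 1)) ((2 : ℝ) ^ k) F hF
  refine le_trans ?_ (minkowski_lint (Measure.count : Measure ℤ) ν
    (fun k t => cc α k₀ k * mixI n p pt ((2 : ℝ) ^ (k - 1)) ((2 : ℝ) ^ k) fun x => F x t) ?_ q hq)
  · gcongr with k
    rw [lintegral_const_mul _ (hm k)]
    gcongr
    exact mixI_minkowski n p pt hp hpt _ _ ν F hF
  · exact measurable_from_prod_countable_right fun k => (hm k).const_mul (cc α k₀ k)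

theorem TT_shift (n : ℕ) (α q p pt : ℝ) (hq : 1 < q) (k₀ j : ℤ)
    (G : EuclideanSpace ℝ (Fin n) → ℝ≥0∞) :
    (∑' k : ℤ, (cc α k₀ k * mixI n p pt ((2 : ℝ) ^ (k + j - 1)) ((2 : ℝ) ^ (k + j)) G) ^ q)
      ^ (1 / q) = ENNReal.ofReal (((2 : ℝ) ^ j) ^ (-α)) * TT n α q p pt (k₀ + j) G := by
  have hq0 : 0 < q := by linarith
  have hj : (0 : ℝ) < 2 ^ j := by positivity
  unfold TT
  rw [← (Equiv.addRight j).tsum_eq (fun k =>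
    (cc α (k₀ + j) k * mixI n p pt ((2 : ℝ) ^ (k - 1)) ((2 : ℝ) ^ k) G) ^ q)]
  have h1 : ∀ k : ℤ,
      (cc α k₀ k * mixI n p pt ((2 : ℝ) ^ (k + j - 1)) ((2 : ℝ) ^ (k + j)) G) ^ q =
      ENNReal.ofReal (((2 : ℝ) ^ j) ^ (-α)) ^ q *
      (cc α (k₀ + j) (k + j) * mixI n p pt ((2 : ℝ) ^ (k + j - 1)) ((2 : ℝ) ^ (k + j)) G) ^ q := by
    intro k
    have hk : (0 : ℝ) < 2 ^ k := by positivity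
    rw [← ENNReal.mul_rpow_of_nonneg _ _ hq0.le, ← mul_assoc]
    congr 2
    unfold cc
    simp only [add_le_add_iff_right]
    split_ifs
    · rw [← ENNReal.ofReal_mul (by positivity), zpow_add₀ two_ne_zero, Real.mul_rpow hk.le hj.le,
        mul_left_comm, ← Real.rpow_add hj]
      simp
    · simp
  simp_rw [h1]
  rw [ENNReal.tsum_mul_left, ENNReal.mul_rpow_of_nonneg _ _ (by positivity), ← ENNReal.rpow_mul,
      mul_one_div_cancel hq0.ne', ENNReal.rpow_one]
  rfl

theorem rpow_comp (x t γ : ℝ) (ht : 0 < t) (h1 : t / 2 ≤ x) (h2 : x ≤ 2 * t) :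
    x ^ γ ≤ 2 ^ |γ| * t ^ γ := by
  have hx : 0 < x := by linarith
  rcases le_total 0 γ with h | h
  · rw [abs_of_nonneg h, ← Real.mul_rpow (by norm_num) ht.le]
    exact Real.rpow_le_rpow hx.le h2 h
  · rw [abs_of_nonpos h, Real.rpow_neg (by norm_num), ← Real.inv_rpow (by norm_num),
      ← Real.mul_rpow (by norm_num) ht.le]
    exact Real.rpow_le_rpow_of_nonpos (by positivity) (by linarith) h

theorem TT_scale (n : ℕ) (α lam q p pt : ℝ) (hp : 1 < p) (hq : 1 < q)
    (k₀ : ℤ) (G : EuclideanSpace ℝ (Fin n) → ℝ≥0∞) (M : ℝ≥0∞)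
    (hM : ∀ k : ℤ, TT n α q p pt k G ≤ ENNReal.ofReal (((2 : ℝ) ^ k) ^ lam) * M)
    (t : ℝ) (ht : 0 < t) :
    TT n α q p pt k₀ (fun x => G (t • x)) ≤
      ENNReal.ofReal (t ^ (-α - n / p + lam)) * (ENNReal.ofReal (2 * 2 ^ |lam - α|) *
        (ENNReal.ofReal (((2 : ℝ) ^ k₀) ^ lam) * M)) := by
  have hq0 : 0 < q := by linarith
  obtain ⟨j, hj1, hj2⟩ := exists_mem_Ioc_zpow ht (one_lt_two : (1 : ℝ) < 2)
  set u := ENNReal.ofReal (t ^ (-(n / p) : ℝ)) with hu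
  set P : ℤ → ℤ → ℝ≥0∞ := fun i k =>
    cc α k₀ k * mixI n p pt ((2 : ℝ) ^ (k + i - 1)) ((2 : ℝ) ^ (k + i)) G with hP
  have hPb : ∀ i : ℤ, t / 2 ≤ (2 : ℝ) ^ i → (2 : ℝ) ^ i ≤ 2 * t →
      (∑' k, P i k ^ q) ^ (1 / q) ≤ ENNReal.ofReal (2 ^ |lam - α| * t ^ (lam - α)) *
        (ENNReal.ofReal (((2 : ℝ) ^ k₀) ^ lam) * M) := by
    intro i h1 h2
    have hi : (0 : ℝ) < 2 ^ i := by positivity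
    have hk : (0 : ℝ) < 2 ^ k₀ := by positivity
    rw [hP, TT_shift n α q p pt hq k₀ i G]
    calc _ ≤ ENNReal.ofReal (((2 : ℝ) ^ i) ^ (-α)) *
          (ENNReal.ofReal (((2 : ℝ) ^ (k₀ + i)) ^ lam) * M) := by gcongr; exact hM _
      _ = ENNReal.ofReal (((2 : ℝ) ^ i) ^ (lam - α)) *
          (ENNReal.ofReal (((2 : ℝ) ^ k₀) ^ lam) * M) := by
        rw [← mul_assoc, ← mul_assoc, ← ENNReal.ofReal_mul (by positivity),
          ← ENNReal.ofReal_mul (by positivity), zpow_add₀ two_ne_zero,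
          Real.mul_rpow hk.le hi.le, mul_left_comm, ← Real.rpow_add hi,
          show -α + lam = lam - α by ring, mul_comm (((2 : ℝ) ^ k₀) ^ lam)]
      _ ≤ _ := by
        gcongr
        exact rpow_comp _ _ _ ht h1 h2
  have hstep : ∀ k : ℤ, cc α k₀ k * mixI n p pt ((2 : ℝ) ^ (k - 1)) ((2 : ℝ) ^ k)
      (fun x => G (t • x)) ≤ u * (P j k + P (j + 1) k) := by
    intro k
    rw [mixI_scale n p pt hp t _ _ ht (by positivity), hP]
    simp only
    rw [← mul_add, mul_left_comm]
    gcongr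
    have e : k + (j + 1) - 1 = k + j := by ring
    rw [e]
    refine mixI_union n p pt hp ?_ G
    intro r hr
    have h1 : (2 : ℝ) ^ (k + j - 1) < r := by
      refine lt_of_le_of_lt ?_ hr.1
      rw [show k + j - 1 = j + (k - 1) by ring, zpow_add₀ two_ne_zero]
      gcongr
    have h2 : r ≤ (2 : ℝ) ^ (k + (j + 1)) := by
      refine hr.2.trans ?_
      rw [show k + (j + 1) = (j + 1) + k by ring, zpow_add₀ two_ne_zero (j + 1)]
      gcongr
    rcases le_or_gt r ((2 : ℝ) ^ (k + j)) with h | h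
    · exact Or.inl ⟨h1, h⟩
    · exact Or.inr ⟨h, h2⟩
  have hj3 : (2 : ℝ) ^ (j + 1) = 2 * 2 ^ j := by
    rw [zpow_add₀ two_ne_zero]; simp [mul_comm]
  have hadd : (∑' k, (P j k + P (j + 1) k) ^ q) ^ (1 / q) ≤
      (∑' k, P j k ^ q) ^ (1 / q) + (∑' k, P (j + 1) k ^ q) ^ (1 / q) := by
    have := ENNReal.lintegral_Lp_add_le (μ := (Measure.count : Measure ℤ)) (f := P j)
      (g := P (j + 1)) (Measurable.of_discrete).aemeasurable (Measurable.of_discrete).aemeasurable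
      hq.le
    simpa [lintegral_count] using this
  calc TT n α q p pt k₀ (fun x => G (t • x))
      ≤ (∑' k, (u * (P j k + P (j + 1) k)) ^ q) ^ (1 / q) := by
        unfold TT
        refine ENNReal.rpow_le_rpow (ENNReal.tsum_le_tsum fun k => ?_) (by positivity)
        exact ENNReal.rpow_le_rpow (hstep k) hq0.le
    _ = u * (∑' k, (P j k + P (j + 1) k) ^ q) ^ (1 / q) := by
        simp_rw [ENNReal.mul_rpow_of_nonneg _ _ hq0.le]
        rw [ENNReal.tsum_mul_left, ENNReal.mul_rpow_of_nonneg _ _ (by positivity),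
          ← ENNReal.rpow_mul, mul_one_div_cancel hq0.ne', ENNReal.rpow_one]
    _ ≤ u * ((∑' k, P j k ^ q) ^ (1 / q) + (∑' k, P (j + 1) k ^ q) ^ (1 / q)) := by gcongr
    _ ≤ u * (ENNReal.ofReal (2 ^ |lam - α| * t ^ (lam - α)) *
        (ENNReal.ofReal (((2 : ℝ) ^ k₀) ^ lam) * M) +
        ENNReal.ofReal (2 ^ |lam - α| * t ^ (lam - α)) *
        (ENNReal.ofReal (((2 : ℝ) ^ k₀) ^ lam) * M)) := by
        gcongr
        · exact hPb j (by linarith) (by linarith)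
        · exact hPb (j + 1) (by linarith) (by linarith)
    _ = _ := by
        rw [← add_mul, ← mul_assoc, ← mul_assoc (ENNReal.ofReal (t ^ (-α - n / p + lam))),
          ← ENNReal.ofReal_add (by positivity) (by positivity), hu,
          ← ENNReal.ofReal_mul (by positivity), ← ENNReal.ofReal_mul (by positivity)]
        congr 2
        rw [show -α - n / p + lam = -(n / p) + (lam - α) by ring, Real.rpow_add ht]
        ring

theorem upper_bound (n : ℕ) (α lam p q pt : ℝ)
    (hp : 1 < p) (hq : 1 < q) (hpt : 1 < pt)
    (ψ : ℝ → ℝ) (hψ0 : ∀ t ∈ Icc (0 : ℝ) 1, 0 ≤ ψ t) (hψm : Measurable ψ)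
    (f : EuclideanSpace ℝ (Fin n) → ℝ) (hf : Measurable f) :
    morreyHerzNorm n α q lam p pt (hardyLittlewoodAvg n ψ f)
            ≤ ENNReal.ofReal (2 * 2 ^ |lam - α|) *
              (∫⁻ t in Ioc (0 : ℝ) 1, ENNReal.ofReal (t ^ (-α - n / p + lam) * ψ t)) *
              morreyHerzNorm n α q lam p pt f := by
  set M := morreyHerzNorm n α q lam p pt f with hMdef
  set β : ℝ := -α - n / p + lam with hβ
  set G : EuclideanSpace ℝ (Fin n) → ℝ≥0∞ := fun x => ENNReal.ofReal |f x| with hG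
  have hGm : Measurable G := by
    rw [hG]; exact ENNReal.measurable_ofReal.comp (measurable_norm.comp hf)
  have hcancel : ∀ k : ℤ, ENNReal.ofReal (((2 : ℝ) ^ k) ^ lam) *
      ENNReal.ofReal (((2 : ℝ) ^ k) ^ (-lam)) = 1 := by
    intro k
    have hk : (0 : ℝ) < 2 ^ k := by positivity
    rw [← ENNReal.ofReal_mul (by positivity), ← Real.rpow_add hk]
    simp
  have hM : ∀ k : ℤ, TT n α q p pt k G ≤ ENNReal.ofReal (((2 : ℝ) ^ k) ^ lam) * M := by
    intro k
    rw [hMdef, morreyHerzNorm_eq n α q lam p pt hq]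
    calc TT n α q p pt k G = ENNReal.ofReal (((2 : ℝ) ^ k) ^ lam) *
          (ENNReal.ofReal (((2 : ℝ) ^ k) ^ (-lam)) * TT n α q p pt k G) := by
          rw [← mul_assoc, hcancel, one_mul]
      _ ≤ _ := by
          gcongr
          exact le_iSup (fun k₀ : ℤ => ENNReal.ofReal (((2 : ℝ) ^ k₀) ^ (-lam)) *
            TT n α q p pt k₀ G) k
  have hψe : Measurable fun t => ENNReal.ofReal (ψ t) := hψm.ennreal_ofReal
  set ν : Measure ℝ := (volume.restrict (Ioc (0 : ℝ) 1)).withDensity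
    (fun t => ENNReal.ofReal (ψ t)) with hν
  have hnu : ∀ g : ℝ → ℝ≥0∞, ∫⁻ t, g t ∂ν = ∫⁻ t in Ioc (0 : ℝ) 1, ENNReal.ofReal (ψ t) * g t := by
    intro g
    rw [hν, lintegral_withDensity_eq_lintegral_mul_non_measurable _ hψe
      (Filter.Eventually.of_forall fun _ => ENNReal.ofReal_lt_top)]
    rfl
  have hU : ∀ x, ENNReal.ofReal |hardyLittlewoodAvg n ψ f x| ≤ ∫⁻ t, G (t • x) ∂ν := by
    intro x
    rw [hnu]
    unfold hardyLittlewoodAvg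
    rw [← Real.enorm_eq_ofReal_abs]
    refine (enorm_integral_le_lintegral_enorm _).trans ?_
    refine setLIntegral_mono' measurableSet_Ioc fun t ht => ?_
    rw [enorm_mul, mul_comm, Real.enorm_eq_ofReal_abs, Real.enorm_eq_ofReal_abs,
      abs_of_nonneg (hψ0 t ⟨ht.1.le, ht.2⟩)]
  have hFm : Measurable (Function.uncurry fun (x : EuclideanSpace ℝ (Fin n)) (t : ℝ) =>
      G (t • x)) := hGm.comp (measurable_snd.smul measurable_fst)
  rw [morreyHerzNorm_eq n α q lam p pt hq]
  refine iSup_le fun k₀ => ?_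
  set K := ENNReal.ofReal (2 * 2 ^ |lam - α|) * (ENNReal.ofReal (((2 : ℝ) ^ k₀) ^ lam) * M) with hK
  have hIm : Measurable fun t : ℝ => ENNReal.ofReal (t ^ β * ψ t) := by fun_prop
  have hT : TT n α q p pt k₀ (fun x => ENNReal.ofReal |hardyLittlewoodAvg n ψ f x|) ≤
      (∫⁻ t in Ioc (0 : ℝ) 1, ENNReal.ofReal (t ^ β * ψ t)) * K := by
    refine (TT_mono n α q p pt hp hpt hq k₀ hU).trans ?_
    refine (TT_minkowski n α q p pt hp hpt hq k₀ ν (fun x t => G (t • x)) hFm).trans ?_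
    rw [hnu, ← lintegral_mul_const _ hIm]
    refine setLIntegral_mono' measurableSet_Ioc fun t ht => ?_
    rw [ENNReal.ofReal_mul (Real.rpow_nonneg ht.1.le _), mul_right_comm, mul_comm]
    gcongr
    exact TT_scale n α lam q p pt hp hq k₀ G M hM t ht.1
  calc _ ≤ ENNReal.ofReal (((2 : ℝ) ^ k₀) ^ (-lam)) *
        ((∫⁻ t in Ioc (0 : ℝ) 1, ENNReal.ofReal (t ^ β * ψ t)) * K) := by gcongr
    _ = (ENNReal.ofReal (((2 : ℝ) ^ k₀) ^ lam) * ENNReal.ofReal (((2 : ℝ) ^ k₀) ^ (-lam))) *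
        (ENNReal.ofReal (2 * 2 ^ |lam - α|) *
          (∫⁻ t in Ioc (0 : ℝ) 1, ENNReal.ofReal (t ^ β * ψ t)) * M) := by rw [hK]; ring
    _ = _ := by rw [hcancel, one_mul]

theorem test_image (n : ℕ) (α lam p q pt : ℝ)
    (hp : 1 < p) (hq : 1 < q) (hpt : 1 < pt)
    (ψ : ℝ → ℝ) (hψ0 : ∀ t ∈ Icc (0 : ℝ) 1, 0 ≤ ψ t) (hψm : Measurable ψ)
    (hI : (∫⁻ t in Ioc (0 : ℝ) 1, ENNReal.ofReal (t ^ (-α - n / p + lam) * ψ t)) ≠ ⊤) :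
    morreyHerzNorm n α q lam p pt (hardyLittlewoodAvg n ψ
      (fun x => ‖x‖ ^ (-α - n / p + lam))) =
      (∫⁻ t in Ioc (0 : ℝ) 1, ENNReal.ofReal (t ^ (-α - n / p + lam) * ψ t)) *
      morreyHerzNorm n α q lam p pt (fun x => ‖x‖ ^ (-α - n / p + lam)) := by
  set β : ℝ := -α - n / p + lam with hβ
  have hnn : ∀ t ∈ Ioc (0 : ℝ) 1, 0 ≤ t ^ β * ψ t := fun t ht =>
    mul_nonneg (Real.rpow_nonneg ht.1.le _) (hψ0 t ⟨ht.1.le, ht.2⟩)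
  have hint : ENNReal.ofReal (∫ t in Ioc (0 : ℝ) 1, t ^ β * ψ t) =
      ∫⁻ t in Ioc (0 : ℝ) 1, ENNReal.ofReal (t ^ β * ψ t) := by
    rw [integral_eq_lintegral_of_nonneg_ae, ENNReal.ofReal_toReal hI]
    · filter_upwards [ae_restrict_mem measurableSet_Ioc] with t ht using hnn t ht
    · exact Measurable.aestronglyMeasurable (by fun_prop)
  rw [morreyHerzNorm_eq n α q lam p pt hq, morreyHerzNorm_eq n α q lam p pt hq, ENNReal.mul_iSup]
  congr 1
  ext k₀
  rw [TT_const_mul n α q p pt hp hpt hq k₀ _ hI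
    (H := fun x => ENNReal.ofReal |‖x‖ ^ β|), mul_left_comm]
  intro x hx
  rw [← hint, ← ENNReal.ofReal_mul (setIntegral_nonneg measurableSet_Ioc hnn)]
  congr 1
  unfold hardyLittlewoodAvg
  have h1 : ∫ t in Ioc (0 : ℝ) 1, ‖t • x‖ ^ β * ψ t =
      ∫ t in Ioc (0 : ℝ) 1, (t ^ β * ψ t) * ‖x‖ ^ β := by
    refine setIntegral_congr_fun measurableSet_Ioc fun t ht => ?_
    change ‖t • x‖ ^ β * ψ t = (t ^ β * ψ t) * ‖x‖ ^ β
    rw [norm_smul, Real.norm_of_nonneg ht.1.le, Real.mul_rpow ht.1.le (norm_nonneg _)]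
    ring
  rw [h1, integral_mul_const, abs_mul, abs_of_nonneg (setIntegral_nonneg measurableSet_Ioc hnn)]

theorem test_mix (n : ℕ) (hn : 1 ≤ n) (β p pt : ℝ) (hp : 1 < p) (hpt : 1 < pt) :
    mixI n p pt (1 / 2) 1 (fun x => ENNReal.ofReal |‖x‖ ^ β|) ≠ 0 ∧
    mixI n p pt (1 / 2) 1 (fun x => ENNReal.ofReal |‖x‖ ^ β|) ≠ ⊤ := by
  have hp0 : 0 < p := by linarith
  have hpt0 : 0 < pt := by linarith
  have hlow : ∀ r ∈ Ioc (1 / 2 : ℝ) 1, ∀ γ : ℝ, (2 ^ |γ|)⁻¹ ≤ r ^ γ := by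
    intro r hr γ
    have hr0 : 0 < r := by linarith [hr.1]
    have := rpow_comp r 1 (-γ) one_pos (by linarith [hr.1]) (by linarith [hr.2])
    rw [abs_neg, Real.one_rpow, mul_one, Real.rpow_neg hr0.le] at this
    exact inv_le_of_inv_le₀ (by positivity) this
  have hup : ∀ r ∈ Ioc (1 / 2 : ℝ) 1, ∀ γ : ℝ, r ^ γ ≤ 2 ^ |γ| := by
    intro r hr γ
    have := rpow_comp r 1 γ one_pos (by linarith [hr.1]) (by linarith [hr.2])
    simpa using this
  have : NeZero n := ⟨by omega⟩
  have hσ0 : sphereMeasure n univ ≠ 0 := by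
    have : Nonempty (Fin n) := ⟨⟨0, by omega⟩⟩
    unfold sphereMeasure
    rw [Ne, Measure.measure_univ_eq_zero]
    exact Measure.toSphere_ne_zero _
  have hσt : sphereMeasure n univ ≠ ⊤ := measure_ne_top _ _
  have hin : ∀ r ∈ Ioc (1 / 2 : ℝ) 1, (∫⁻ θ : sphere (0 : EuclideanSpace ℝ (Fin n)) 1,
        ENNReal.ofReal |‖r • (θ : EuclideanSpace ℝ (Fin n))‖ ^ β| ^ pt
      ∂(sphereMeasure n)) = ENNReal.ofReal (r ^ β) ^ pt * sphereMeasure n univ := by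
    intro r hr
    have hr0 : 0 < r := by linarith [hr.1]
    have : ∀ θ : sphere (0 : EuclideanSpace ℝ (Fin n)) 1,
        ENNReal.ofReal |‖r • (θ : EuclideanSpace ℝ (Fin n))‖ ^ β| ^ pt =
        ENNReal.ofReal (r ^ β) ^ pt := by
      intro θ
      rw [norm_smul, norm_eq_of_mem_sphere, mul_one, Real.norm_of_nonneg hr0.le,
        abs_of_nonneg (by positivity)]
    simp_rw [this]
    rw [lintegral_const]
  have hvol : volume (Ioc (1 / 2 : ℝ) 1) = ENNReal.ofReal (1 / 2) := by
    rw [Real.volume_Ioc]; norm_num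
  set c : ℝ → ℝ → ℝ≥0∞ := fun u v =>
    (ENNReal.ofReal u ^ pt * sphereMeasure n univ) ^ (p / pt) * ENNReal.ofReal v with hc
  unfold mixI
  constructor
  · have h1 : c (2 ^ |β|)⁻¹ (2 ^ |(n : ℝ) - 1|)⁻¹ * volume (Ioc (1 / 2 : ℝ) 1) ≤
      ∫⁻ r in Ioc (1 / 2 : ℝ) 1, (∫⁻ θ : sphere (0 : EuclideanSpace ℝ (Fin n)) 1,
        ENNReal.ofReal |‖r • (θ : EuclideanSpace ℝ (Fin n))‖ ^ β| ^ pt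
      ∂(sphereMeasure n)) ^ (p / pt) * ENNReal.ofReal (r ^ ((n : ℝ) - 1)) := by
      rw [← setLIntegral_const]
      refine setLIntegral_mono' measurableSet_Ioc fun r hr => ?_
      rw [hin r hr, hc]
      have := hlow r hr β
      have := hlow r hr ((n : ℝ) - 1)
      simp only
      gcongr
    have h2 : c (2 ^ |β|)⁻¹ (2 ^ |(n : ℝ) - 1|)⁻¹ * volume (Ioc (1 / 2 : ℝ) 1) ≠ 0 := by
      rw [hvol, hc]
      refine mul_ne_zero (mul_ne_zero ?_ ?_) ?_
      · refine (ENNReal.rpow_pos (pos_iff_ne_zero.2 (mul_ne_zero ?_ hσ0)) ?_).ne'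
        · exact (ENNReal.rpow_pos (ENNReal.ofReal_pos.2 (by positivity)) ENNReal.ofReal_ne_top).ne'
        · exact ENNReal.mul_ne_top (ENNReal.rpow_ne_top_of_nonneg hpt0.le ENNReal.ofReal_ne_top) hσt
      · exact (ENNReal.ofReal_pos.2 (by positivity)).ne'
      · exact (ENNReal.ofReal_pos.2 (by positivity)).ne'
    intro h
    rw [ENNReal.rpow_eq_zero_iff_of_pos (by positivity)] at h
    rw [h] at h1
    exact h2 (le_antisymm h1 zero_le)
  · refine ENNReal.rpow_ne_top_of_nonneg (by positivity) ?_
    have h1 : ∫⁻ r in Ioc (1 / 2 : ℝ) 1, (∫⁻ θ : sphere (0 : EuclideanSpace ℝ (Fin n)) 1,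
        ENNReal.ofReal |‖r • (θ : EuclideanSpace ℝ (Fin n))‖ ^ β| ^ pt
      ∂(sphereMeasure n)) ^ (p / pt) * ENNReal.ofReal (r ^ ((n : ℝ) - 1)) ≤
        c (2 ^ |β|) (2 ^ |(n : ℝ) - 1|) * volume (Ioc (1 / 2 : ℝ) 1) := by
      rw [← setLIntegral_const]
      refine setLIntegral_mono' measurableSet_Ioc fun r hr => ?_
      rw [hin r hr, hc]
      have := hup r hr β
      have := hup r hr ((n : ℝ) - 1)
      simp only
      gcongr
    refine ne_top_of_le_ne_top ?_ h1
    rw [hvol, hc]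
    refine ENNReal.mul_ne_top (ENNReal.mul_ne_top ?_ ENNReal.ofReal_ne_top) ENNReal.ofReal_ne_top
    exact ENNReal.rpow_ne_top_of_nonneg (by positivity)
      (ENNReal.mul_ne_top (ENNReal.rpow_ne_top_of_nonneg hpt0.le ENNReal.ofReal_ne_top) hσt)

theorem test_norm (n : ℕ) (hn : 1 ≤ n) (α lam p q pt : ℝ)
    (hlam : 0 < lam) (hp : 1 < p) (hq : 1 < q) (hpt : 1 < pt) :
    morreyHerzNorm n α q lam p pt (fun x => ‖x‖ ^ (-α - n / p + lam)) ≠ 0 ∧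
    morreyHerzNorm n α q lam p pt (fun x => ‖x‖ ^ (-α - n / p + lam)) ≠ ⊤ := by
  have hq0 : 0 < q := by linarith
  set β : ℝ := -α - n / p + lam with hβ
  obtain ⟨hN0, hNt⟩ := test_mix n hn β p pt hp hpt
  set G : EuclideanSpace ℝ (Fin n) → ℝ≥0∞ := fun x => ENNReal.ofReal |‖x‖ ^ β| with hG
  set N := mixI n p pt (1 / 2) 1 G with hN
  have hmix : ∀ k : ℤ, mixI n p pt ((2 : ℝ) ^ (k - 1)) ((2 : ℝ) ^ k) G =
      ENNReal.ofReal (((2 : ℝ) ^ k) ^ (lam - α)) * N := by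
    intro k
    set s : ℝ := 2 ^ k with hs
    have hs0 : 0 < s := by positivity
    have h1 := mixI_scale n p pt hp s (1 / 2) 1 hs0 (by norm_num) G
    rw [mixI_const_mul n p pt hp hpt _ _ (by norm_num) (ENNReal.ofReal (s ^ β))
      ENNReal.ofReal_ne_top (H := G), ← hN] at h1
    · have e : (2 : ℝ) ^ (k - 1) = s * (1 / 2) := by
        rw [zpow_sub₀ two_ne_zero, hs]; simp [div_eq_mul_inv]
      rw [mul_one] at h1
      rw [e]
      calc mixI n p pt (s * (1 / 2)) s G = ENNReal.ofReal (s ^ (n / p : ℝ)) *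
            (ENNReal.ofReal (s ^ (-(n / p) : ℝ)) * mixI n p pt (s * (1 / 2)) s G) := by
            rw [← mul_assoc, ← ENNReal.ofReal_mul (by positivity), ← Real.rpow_add hs0]
            simp
        _ = _ := by
            rw [← h1, ← mul_assoc, ← ENNReal.ofReal_mul (by positivity), ← Real.rpow_add hs0]
            congr 3
            rw [hβ]; ring
    · intro x _
      rw [hG]
      simp only
      rw [← ENNReal.ofReal_mul (by positivity), norm_smul, Real.norm_of_nonneg hs0.le,
        Real.mul_rpow hs0.le (norm_nonneg _), abs_mul, abs_of_nonneg (Real.rpow_nonneg hs0.le β)]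
  have hTT0 : TT n α q p pt 0 G = (∑' k : ℤ, (cc lam 0 k * N) ^ q) ^ (1 / q) := by
    unfold TT
    congr 2
    ext k
    rw [hmix, ← mul_assoc]
    congr 2
    unfold cc
    split_ifs
    · have hk : (0 : ℝ) < 2 ^ k := by positivity
      rw [← ENNReal.ofReal_mul (by positivity), ← Real.rpow_add hk]
      congr 2
      ring
    · simp
  have hTTj : ∀ j : ℤ, ENNReal.ofReal (((2 : ℝ) ^ j) ^ (-lam)) * TT n α q p pt j G =
      TT n α q p pt 0 G := by
    intro j
    have hj : (0 : ℝ) < 2 ^ j := by positivity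
    have h1 := TT_shift n α q p pt hq 0 j G
    have h2 : ∀ k : ℤ,
        (cc α 0 k * mixI n p pt ((2 : ℝ) ^ (k + j - 1)) ((2 : ℝ) ^ (k + j)) G) ^ q =
        ENNReal.ofReal (((2 : ℝ) ^ j) ^ (lam - α)) ^ q *
        (cc α 0 k * mixI n p pt ((2 : ℝ) ^ (k - 1)) ((2 : ℝ) ^ k) G) ^ q := by
      intro k
      have hk : (0 : ℝ) < 2 ^ k := by positivity
      rw [← ENNReal.mul_rpow_of_nonneg _ _ hq0.le, hmix, hmix, zpow_add₀ two_ne_zero,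
        Real.mul_rpow hk.le hj.le, ENNReal.ofReal_mul (by positivity)]
      congr 1
      ring
    simp_rw [h2] at h1
    rw [ENNReal.tsum_mul_left, ENNReal.mul_rpow_of_nonneg _ _ (by positivity), ← ENNReal.rpow_mul,
      mul_one_div_cancel hq0.ne', ENNReal.rpow_one, zero_add] at h1
    have h3 : ENNReal.ofReal (((2 : ℝ) ^ j) ^ (lam - α)) * TT n α q p pt 0 G =
      ENNReal.ofReal (((2 : ℝ) ^ j) ^ (-α)) * TT n α q p pt j G := h1
    calc _ = ENNReal.ofReal (((2 : ℝ) ^ j) ^ (α - lam)) *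
          (ENNReal.ofReal (((2 : ℝ) ^ j) ^ (-α)) * TT n α q p pt j G) := by
          rw [← mul_assoc, ← ENNReal.ofReal_mul (by positivity), ← Real.rpow_add hj]
          congr 3
          ring
      _ = _ := by
          rw [← h3, ← mul_assoc, ← ENNReal.ofReal_mul (by positivity), ← Real.rpow_add hj]
          simp
  have hnorm : morreyHerzNorm n α q lam p pt (fun x => ‖x‖ ^ β) = TT n α q p pt 0 G := by
    rw [morreyHerzNorm_eq n α q lam p pt hq]
    simp_rw [← hG, hTTj]
    exact iSup_const
  rw [hnorm, hTT0]
  constructor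
  · intro h
    rw [ENNReal.rpow_eq_zero_iff_of_pos (by positivity), ENNReal.tsum_eq_zero] at h
    have := h 0
    rw [ENNReal.rpow_eq_zero_iff_of_pos hq0] at this
    simp [cc] at this
    exact hN0 this
  · refine ENNReal.rpow_ne_top_of_nonneg (by positivity) ?_
    have hinj : Function.Injective (fun m : ℕ => -(m : ℤ)) := by
      intro a b h; simpa using h
    rw [← hinj.tsum_eq]
    · have h1 : ∀ m : ℕ, (cc lam 0 (-(m : ℤ)) * N) ^ q =
          ENNReal.ofReal (2 ^ (-(lam * q))) ^ m * N ^ q := by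
        intro m
        rw [ENNReal.mul_rpow_of_nonneg _ _ hq0.le]
        congr 1
        unfold cc
        rw [if_pos (by simp), ENNReal.ofReal_rpow_of_pos (by positivity),
          ← ENNReal.ofReal_pow (by positivity), ← Real.rpow_natCast, ← Real.rpow_intCast,
          ← Real.rpow_mul (by norm_num), ← Real.rpow_mul (by norm_num),
          ← Real.rpow_mul (by norm_num)]
        congr 2
        push_cast
        ring
      simp_rw [h1]
      rw [ENNReal.tsum_mul_right, ENNReal.tsum_geometric]
      refine ENNReal.mul_ne_top ?_ (ENNReal.rpow_ne_top_of_nonneg hq0.le hNt)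
      rw [ENNReal.inv_ne_top]
      refine (tsub_pos_of_lt ?_).ne'
      rw [ENNReal.ofReal_lt_one]
      exact Real.rpow_lt_one_of_one_lt_of_neg (by norm_num) (by nlinarith [mul_pos hlam hq0])
    · intro k hk
      by_contra hc
      apply hk
      have : ¬ k ≤ 0 := by
        intro hk0
        exact hc ⟨(-k).toNat, by change -(((-k).toNat : ℕ) : ℤ) = k; omega⟩
      simp [cc, this, hq0]

/-- If `∫₀¹ t^{-α-n/p+λ} ψ(t) dt < ∞` then `U_ψ` is bounded on the mixed radial-angular
homogeneous Morrey–Herz space `MK̇^{α,q,λ}_{L^p_{rad}L^{p̃}_{ang}}(ℝⁿ)`, with operator norm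
comparable (with constants independent of `ψ`) to `∫₀¹ t^{-α-n/p+λ} ψ(t) dt`. -/
theorem hardyLittlewoodAvg_morreyHerz (n : ℕ) (hn : 1 ≤ n) (α lam p q pt : ℝ)
    (hlam : 0 < lam) (hp : 1 < p) (hq : 1 < q) (hpt : 1 < pt) :
    ∃ c C : ℝ≥0∞, 0 < c ∧ C < ⊤ ∧
      ∀ ψ : ℝ → ℝ, (∀ t ∈ Icc (0 : ℝ) 1, 0 ≤ ψ t) → Measurable ψ →
        (∫⁻ t in Ioc (0 : ℝ) 1, ENNReal.ofReal (t ^ (-α - n / p + lam) * ψ t)) < ⊤ →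
        (∀ f : EuclideanSpace ℝ (Fin n) → ℝ, Measurable f →
          morreyHerzNorm n α q lam p pt f < ⊤ →
          morreyHerzNorm n α q lam p pt (hardyLittlewoodAvg n ψ f)
            ≤ C * (∫⁻ t in Ioc (0 : ℝ) 1, ENNReal.ofReal (t ^ (-α - n / p + lam) * ψ t)) *
              morreyHerzNorm n α q lam p pt f) ∧
        (∀ D : ℝ≥0∞,
          (∀ f : EuclideanSpace ℝ (Fin n) → ℝ, Measurable f →
            morreyHerzNorm n α q lam p pt f < ⊤ →
            morreyHerzNorm n α q lam p pt (hardyLittlewoodAvg n ψ f)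
              ≤ D * morreyHerzNorm n α q lam p pt f) →
          c * (∫⁻ t in Ioc (0 : ℝ) 1, ENNReal.ofReal (t ^ (-α - n / p + lam) * ψ t)) ≤ D) := by
  set β : ℝ := -α - n / p + lam with hβ
  refine ⟨1, ENNReal.ofReal (2 * 2 ^ |lam - α|), one_pos, ENNReal.ofReal_lt_top, ?_⟩
  intro ψ hψ0 hψm hI
  refine ⟨fun f hf _ => upper_bound n α lam p q pt hp hq hpt ψ hψ0 hψm f hf, ?_⟩
  intro D hD
  have hf0 : Measurable (fun x : EuclideanSpace ℝ (Fin n) => ‖x‖ ^ β) :=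
    measurable_norm.pow_const _
  obtain ⟨hN0, hNt⟩ := test_norm n hn α lam p q pt hlam hp hq hpt
  have h := hD _ hf0 hNt.lt_top
  rw [test_image n α lam p q pt hp hq hpt ψ hψ0 hψm hI.ne] at h
  rw [one_mul]
  exact (ENNReal.mul_le_mul_iff_left hN0 hNt).1 h
end
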